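/- arXiv:2206.02028 — 5 statements merged into one kernel-verified Lean document; each statement's English description precedes it below -/
import Mathlib

section
/- Let m and n be integers with m, n ≥ 2. If there exists a C₄-face-magic Klein bottle labeling on the m×n Klein bottle grid graph 𝒦_{m,n}, then n is even. -/
/-- Reduction of a (positive) index modulo `n` to a representative in `{1, …, n}`. -/
def wrap (n j : ℕ) : ℕ := if j % n = 0 then n else j % n

/-- `x` is a C₄-face-magic Klein bottle labeling of the `m × n` Klein bottle grid graph
`𝒦_{m,n}` with C₄-face-magic value `S`: `x` is a bijection from `{1,…,m} × {1,…,n}`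
onto `{1,…,m*n}` and every C₄-face of the natural embedding of `𝒦_{m,n}` in the Klein
bottle has vertex-label sum `S`. -/
def IsC4FaceMagic (m n : ℕ) (x : ℕ × ℕ → ℕ) (S : ℕ) : Prop :=
  Set.BijOn x (Set.Icc 1 m ×ˢ Set.Icc 1 n) (Set.Icc 1 (m * n)) ∧
  (∀ i j, 1 ≤ i → i + 1 ≤ m → 1 ≤ j → j ≤ n →
    x (i, j) + x (i + 1, j) + x (i, wrap n (j + 1)) + x (i + 1, wrap n (j + 1)) = S) ∧
  (∀ j, 1 ≤ j → j ≤ n →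
    x (m, j) + x (m, wrap n (j + 1)) + x (1, n + 1 - j) + x (1, wrap n (n - j)) = S)

theorem wrap_of_pos_of_le {n j : ℕ} (hj : 1 ≤ j) (hjn : j ≤ n) : wrap n j = j := by
  unfold wrap
  rcases hjn.eq_or_lt with rfl | hlt
  · simp
  · rw [Nat.mod_eq_of_lt hlt, if_neg (by omega)]

theorem wrap_zero (n : ℕ) : wrap n 0 = n := by
  simp [wrap]

theorem wrap_succ_self {n : ℕ} (hn : 2 ≤ n) : wrap n (n + 1) = 1 := by
  simp [wrap, Nat.mod_eq_of_lt (show 1 < n by omega)]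

/-- If consecutive terms of a cyclic sequence of odd length have constant sum `S`, then twice
the first term is `S`. -/
theorem two_mul_eq_of_odd_cycle {n S : ℕ} (hn : Odd n) (f : ℕ → ℕ)
    (hstep : ∀ j, 1 ≤ j → j < n → f j + f (j + 1) = S) (hlast : f n + f 1 = S) :
    2 * f 1 = S := by
  have hodd : ∀ k, 2 * k + 1 ≤ n → f (2 * k + 1) = f 1 := by
    intro k
    induction k with
    | zero => simp
    | succ k ih =>
      intro hk
      have h₁ := hstep (2 * k + 1) (by omega) (by omega)
      have h₂ := hstep (2 * k + 1 + 1) (by omega) (by omega)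
      have h₃ := ih (by omega)
      rw [show 2 * (k + 1) + 1 = 2 * k + 1 + 1 + 1 by ring]
      omega
  obtain ⟨k, rfl⟩ := hn
  have := hodd k le_rfl
  omega

/-- If `𝒦_{m,n}` (with `m, n ≥ 2`) admits a C₄-face-magic Klein bottle
labeling, then `n` is even. -/
theorem kleinBottle_magicLabeling_even (m n : ℕ) (hm : 2 ≤ m) (hn : 2 ≤ n)
    (h : ∃ x S, IsC4FaceMagic m n x S) : Even n := by
  obtain ⟨x, S, hbij, hface, htwist⟩ := h
  by_contra hne
  have hodd : Odd n := Nat.not_even_iff_odd.mp hne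
  have hcol : ∀ i, 1 ≤ i → i + 1 ≤ m → 2 * (x (i, 1) + x (i + 1, 1)) = S := by
    intro i hi him
    refine two_mul_eq_of_odd_cycle hodd (fun j => x (i, j) + x (i + 1, j)) ?_ ?_
    · intro j hj hjn
      have h := hface i j hi him hj hjn.le
      rw [wrap_of_pos_of_le (j := j + 1) (by omega) hjn] at h
      omega
    · have h := hface i n hi him (by omega) le_rfl
      rw [wrap_succ_self hn] at h
      omega
  have htw : 2 * (x (m, 1) + x (1, n + 1 - 1)) = S := by
    refine two_mul_eq_of_odd_cycle hodd (fun j => x (m, j) + x (1, n + 1 - j)) ?_ ?_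
    · intro j hj hjn
      have h := htwist j hj hjn.le
      rw [wrap_of_pos_of_le (j := j + 1) (by omega) hjn,
        wrap_of_pos_of_le (j := n - j) (by omega) (by omega)] at h
      rw [show n + 1 - (j + 1) = n - j by omega]
      omega
    · have h := htwist n (by omega) le_rfl
      rw [wrap_succ_self hn, Nat.sub_self, wrap_zero] at h
      rw [Nat.add_sub_cancel]
      omega
  rw [Nat.add_sub_cancel] at htw
  have hinj : ∀ a b c d, 1 ≤ a → a ≤ m → 1 ≤ b → b ≤ n → 1 ≤ c → c ≤ m → 1 ≤ d → d ≤ n →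
      x (a, b) = x (c, d) → a = c ∧ b = d := by
    intro a b c d ha ham hb hbn hc hcm hd hdn hx
    exact Prod.mk.inj (hbij.injOn ⟨⟨ha, ham⟩, ⟨hb, hbn⟩⟩ ⟨⟨hc, hcm⟩, ⟨hd, hdn⟩⟩ hx)
  have h₁ : 2 * (x (1, 1) + x (2, 1)) = S := hcol 1 le_rfl hm
  rcases hm.eq_or_lt with rfl | hm3
  · have := hinj 1 1 1 n (by omega) (by omega) (by omega) (by omega) (by omega) (by omega)
      (by omega) le_rfl (by omega)
    omega
  · have h₂ : 2 * (x (2, 1) + x (3, 1)) = S := hcol 2 (by omega) hm3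
    have := hinj 1 1 3 1 (by omega) (by omega) (by omega) (by omega) (by omega) (by omega)
      (by omega) (by omega) (by omega)
    omega
end

section
/- Let m ≥ 3 be an odd integer and n = 2n₁ an even positive integer. Define x on {1,…,m}×{1,…,n} by: x_{2i−1,2j−1} = (j−1)m + i for 1 ≤ i ≤ (m+1)/2 and 1 ≤ j ≤ ⌊(n₁+1)/2⌋; x_{2i,2j−1} = (n+1−j)m + 1 − (m+1)/2 − i for 1 ≤ i ≤ (m−1)/2 and 1 ≤ j ≤ ⌊(n₁+1)/2⌋; x_{2i−1,2j} = (n₁−j+1)m + 1 − i for 1 ≤ i ≤ (m+1)/2 and 1 ≤ j ≤ ⌊n₁/2⌋; x_{2i,2j} = (n₁+j−1)m + (m+1)/2 + i for 1 ≤ i ≤ (m−1)/2 and 1 ≤ j ≤ ⌊n₁/2⌋; and x_{i,j} = mn + 1 − x_{i,n+1−j} for 1 ≤ i ≤ m and n/2 + 1 ≤ j ≤ n. Then x is a C₄-face-magic Klein bottle labeling on 𝒦_{m,n}. -/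
/-- A map that is antisymmetric under the column reflection `j ↦ n + 1 - j` satisfies the
face conditions as soon as it does so on the left half of the columns. -/
theorem isC4FaceMagic_of_antisymmetric {m n n₁ : ℕ} (hm : 1 ≤ m) (hn₁ : 0 < n₁) (hn : n = 2 * n₁)
    {x : ℕ × ℕ → ℕ}
    (hbij : Set.BijOn x (Set.Icc 1 m ×ˢ Set.Icc 1 n) (Set.Icc 1 (m * n)))
    (hanti : ∀ i j, 1 ≤ i → i ≤ m → 1 ≤ j → j ≤ n → x (i, j) + x (i, n + 1 - j) = m * n + 1)
    (hface : ∀ i j, 1 ≤ i → i + 1 ≤ m → 1 ≤ j → j + 1 ≤ n₁ →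
      x (i, j) + x (i + 1, j) + x (i, j + 1) + x (i + 1, j + 1) = 2 * (m * n + 1))
    (hends : ∀ j, 1 ≤ j → j + 1 ≤ n₁ →
      x (m, j) + x (m, j + 1) = x (1, j) + x (1, j + 1)) :
    IsC4FaceMagic m n x (2 * (m * n + 1)) := by
  have wrap_of_le : ∀ j, 1 ≤ j → j ≤ n → wrap n j = j := by
    intro j hj hjn
    unfold wrap
    obtain rfl | h := hjn.eq_or_lt
    · simp
    · rw [Nat.mod_eq_of_lt h, if_neg (by omega)]
  have wrap_succ : wrap n (n + 1) = 1 := by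
    unfold wrap
    rw [Nat.add_mod_left, Nat.mod_eq_of_lt (by omega), if_neg one_ne_zero]
  have wrap_zero : wrap n 0 = n := by simp [wrap]
  refine ⟨hbij, fun i j hi him hj hjn => ?_, fun j hj hjn => ?_⟩
  · have a₁ := hanti i j hi (by omega) hj hjn
    have a₂ := hanti (i + 1) j (by omega) him hj hjn
    obtain rfl | hlt := hjn.eq_or_lt
    · rw [wrap_succ]
      rw [Nat.add_sub_cancel_left] at a₁ a₂
      omega
    · rw [wrap_of_le (j + 1) (by omega) hlt]
      obtain h | rfl | h := lt_trichotomy j n₁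
      · exact hface i j hi him hj h
      · rw [show n + 1 - j = j + 1 by omega] at a₁ a₂
        omega
      · have b₁ := hanti i (j + 1) hi (by omega) (by omega) hlt
        have b₂ := hanti (i + 1) (j + 1) (by omega) him (by omega) hlt
        have f := hface i (n - j) hi him (by omega) (by omega)
        rw [show n - j + 1 = n + 1 - j by omega] at f
        rw [show n + 1 - (j + 1) = n - j by omega] at b₁ b₂
        omega
  · have a₁ := hanti 1 j le_rfl hm hj hjn
    have a₂ := hanti m j hm le_rfl hj hjn
    obtain rfl | hlt := hjn.eq_or_lt
    · rw [wrap_succ, Nat.sub_self, wrap_zero]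
      rw [Nat.add_sub_cancel_left] at a₁ a₂ ⊢
      omega
    · rw [wrap_of_le (j + 1) (by omega) hlt, wrap_of_le (n - j) (by omega) (by omega)]
      have b₁ := hanti 1 (j + 1) le_rfl hm (by omega) hlt
      have b₂ := hanti m (j + 1) hm le_rfl (by omega) hlt
      rw [show n + 1 - (j + 1) = n - j by omega] at b₁ b₂
      obtain h | rfl | h := lt_trichotomy j n₁
      · have f := hends j hj h
        omega
      · rw [show n + 1 - j = j + 1 by omega] at a₁ a₂ ⊢
        rw [show n - j = j by omega] at b₁ b₂ ⊢
        omega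
      · have f := hends (n - j) (by omega) (by omega)
        rw [show n - j + 1 = n + 1 - j by omega] at f
        omega

/-- The explicit construction of a C₄-face-magic Klein bottle labeling on
`𝒦_{m,n}` for `m ≥ 3` odd and `n = 2n₁` even. -/
theorem kleinBottle_construction_odd (m n n₁ : ℕ) (hm : 3 ≤ m) (hmo : Odd m)
    (hn₁ : 0 < n₁) (hn : n = 2 * n₁) (x : ℕ × ℕ → ℕ)
    (h1 : ∀ i j, 1 ≤ i → i ≤ (m + 1) / 2 → 1 ≤ j → j ≤ (n₁ + 1) / 2 →
      x (2 * i - 1, 2 * j - 1) = (j - 1) * m + i)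
    (h2 : ∀ i j, 1 ≤ i → i ≤ (m - 1) / 2 → 1 ≤ j → j ≤ (n₁ + 1) / 2 →
      x (2 * i, 2 * j - 1) = (n + 1 - j) * m + 1 - (m + 1) / 2 - i)
    (h3 : ∀ i j, 1 ≤ i → i ≤ (m + 1) / 2 → 1 ≤ j → j ≤ n₁ / 2 →
      x (2 * i - 1, 2 * j) = (n₁ - j + 1) * m + 1 - i)
    (h4 : ∀ i j, 1 ≤ i → i ≤ (m - 1) / 2 → 1 ≤ j → j ≤ n₁ / 2 →
      x (2 * i, 2 * j) = (n₁ + j - 1) * m + (m + 1) / 2 + i)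
    (h5 : ∀ i j, 1 ≤ i → i ≤ m → n / 2 + 1 ≤ j → j ≤ n →
      x (i, j) = m * n + 1 - x (i, n + 1 - j)) :
    ∃ S, IsC4FaceMagic m n x S := by
  subst hn
  obtain ⟨k, hk⟩ := hmo
  have e₁ : ∀ i j, i ≤ k → 2 * j + 1 ≤ n₁ → x (2 * i + 1, 2 * j + 1) = j * m + i + 1 := by
    intro i j hi hj
    have h := h1 (i + 1) (j + 1) (by omega) (by omega) (by omega) (by omega)
    rw [show 2 * (i + 1) - 1 = 2 * i + 1 by omega, show 2 * (j + 1) - 1 = 2 * j + 1 by omega,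
      Nat.add_sub_cancel] at h
    omega
  have e₂ : ∀ i j, i < k → 2 * j + 1 ≤ n₁ →
      x (2 * i + 2, 2 * j + 1) + j * m + m + i = 2 * (n₁ * m) + k := by
    intro i j hi hj
    obtain ⟨d, rfl⟩ := Nat.exists_eq_add_of_le hj
    have h := h2 (i + 1) (j + 1) (by omega) (by omega) (by omega) (by omega)
    rw [show 2 * (i + 1) = 2 * i + 2 by omega, show 2 * (j + 1) - 1 = 2 * j + 1 by omega,
      show 2 * (2 * j + 1 + d) + 1 - (j + 1) = 3 * j + 2 * d + 2 by omega,
      show (m + 1) / 2 = k + 1 by omega] at h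
    simp only [add_mul, mul_assoc, one_mul] at h ⊢
    omega
  have e₃ : ∀ i j, i ≤ k → 2 * j + 2 ≤ n₁ → x (2 * i + 1, 2 * j + 2) + j * m + i = n₁ * m := by
    intro i j hi hj
    obtain ⟨d, rfl⟩ := Nat.exists_eq_add_of_le hj
    have h := h3 (i + 1) (j + 1) (by omega) (by omega) (by omega) (by omega)
    rw [show 2 * (i + 1) - 1 = 2 * i + 1 by omega, show 2 * (j + 1) = 2 * j + 2 by omega,
      show 2 * j + 2 + d - (j + 1) + 1 = j + d + 2 by omega] at h
    simp only [add_mul, mul_assoc] at h ⊢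
    omega
  have e₄ : ∀ i j, i < k → 2 * j + 2 ≤ n₁ →
      x (2 * i + 2, 2 * j + 2) = n₁ * m + j * m + k + i + 2 := by
    intro i j hi hj
    have h := h4 (i + 1) (j + 1) (by omega) (by omega) (by omega) (by omega)
    rw [show 2 * (i + 1) = 2 * i + 2 by omega, show 2 * (j + 1) = 2 * j + 2 by omega,
      show n₁ + (j + 1) - 1 = n₁ + j by omega, show (m + 1) / 2 = k + 1 by omega, add_mul] at h
    omega
  have parity : ∀ i, 1 ≤ i → ∃ a, i = 2 * a + 1 ∨ i = 2 * a + 2 := fun i hi =>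
    ⟨(i - 1) / 2, by omega⟩
  have hmn : m * (2 * n₁) = 2 * (n₁ * m) := by ring
  have left_range : ∀ i j, 1 ≤ i → i ≤ m → 1 ≤ j → j ≤ n₁ →
      1 ≤ x (i, j) ∧ x (i, j) ≤ m * (2 * n₁) := by
    intro i j hi him hj hjn
    rw [hmn]
    obtain ⟨b, hb⟩ := parity j hj
    have hbm : b * m + b * m + m ≤ n₁ * m := by
      calc b * m + b * m + m = (2 * b + 1) * m := by ring
        _ ≤ n₁ * m := Nat.mul_le_mul_right m (by omega)
    obtain ⟨a, rfl | rfl⟩ := parity i hi <;> obtain rfl | rfl := hb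
    · have := e₁ a b (by omega) hjn
      omega
    · have := e₃ a b (by omega) hjn
      omega
    · have := e₂ a b (by omega) hjn
      omega
    · have := e₄ a b (by omega) hjn
      omega
  have hanti : ∀ i j, 1 ≤ i → i ≤ m → 1 ≤ j → j ≤ 2 * n₁ →
      x (i, j) + x (i, 2 * n₁ + 1 - j) = m * (2 * n₁) + 1 := by
    intro i j hi him hj hjn
    obtain h | h := le_or_gt j n₁
    · have r := left_range i j hi him hj h
      have := h5 i (2 * n₁ + 1 - j) hi him (by omega) (by omega)
      rw [show 2 * n₁ + 1 - (2 * n₁ + 1 - j) = j by omega] at this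
      omega
    · have r := left_range i (2 * n₁ + 1 - j) hi him (by omega) (by omega)
      have := h5 i j hi him (by omega) hjn
      omega
  have hmaps : Set.MapsTo x (Set.Icc 1 m ×ˢ Set.Icc 1 (2 * n₁)) (Set.Icc 1 (m * (2 * n₁))) := by
    rintro ⟨i, j⟩ ⟨⟨hi, him⟩, hj, hjn⟩
    dsimp only at hi him hj hjn
    rw [Set.mem_Icc]
    obtain h | h := le_or_gt j n₁
    · exact left_range i j hi him hj h
    · have r := left_range i (2 * n₁ + 1 - j) hi him (by omega) (by omega)
      have := hanti i j hi him hj hjn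
      omega
  -- by antisymmetry it suffices to hit one element of each pair `{v, m * n + 1 - v}`
  have hit_low : ∀ v, 1 ≤ v → v ≤ n₁ * m → ∃ i j, (1 ≤ i ∧ i ≤ m) ∧ (1 ≤ j ∧ j ≤ n₁) ∧
      (x (i, j) = v ∨ x (i, j) + v = m * (2 * n₁) + 1) := by
    intro v hv hvn
    obtain ⟨q, r, hr, rfl⟩ : ∃ q r, r < m ∧ v = q * m + r + 1 :=
      ⟨(v - 1) / m, (v - 1) % m, Nat.mod_lt _ (by omega), by
        have := Nat.div_add_mod' (v - 1) m
        omega⟩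
    have hq : q < n₁ := lt_of_mul_lt_mul_right (show q * m < n₁ * m by omega) m.zero_le
    rw [hmn]
    obtain h | h := lt_or_ge q ((n₁ + 1) / 2)
    · obtain hrk | hrk := le_or_gt r k
      · have := e₁ r q hrk (by omega)
        exact ⟨2 * r + 1, 2 * q + 1, by omega, by omega, by omega⟩
      · have := e₂ (r - k - 1) q (by omega) (by omega)
        exact ⟨2 * (r - k - 1) + 2, 2 * q + 1, by omega, by omega, by omega⟩
    · obtain ⟨d, rfl⟩ := Nat.exists_eq_add_of_lt hq
      simp only [add_mul, one_mul] at e₃ e₄ ⊢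
      obtain hrk | hrk := lt_or_ge r k
      · have := e₄ (k - 1 - r) d (by omega) (by omega)
        exact ⟨2 * (k - 1 - r) + 2, 2 * d + 2, by omega, by omega, by omega⟩
      · have := e₃ (m - 1 - r) d (by omega) (by omega)
        exact ⟨2 * (m - 1 - r) + 1, 2 * d + 2, by omega, by omega, by omega⟩
  have hsurj : Set.SurjOn x (Set.Icc 1 m ×ˢ Set.Icc 1 (2 * n₁)) (Set.Icc 1 (m * (2 * n₁))) := by
    rintro v ⟨hv, hvn⟩
    obtain ⟨i, j, hi, hj, h⟩ : ∃ i j, (1 ≤ i ∧ i ≤ m) ∧ (1 ≤ j ∧ j ≤ n₁) ∧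
        (x (i, j) = v ∨ x (i, j) + v = m * (2 * n₁) + 1) := by
      obtain h | h := le_or_gt v (n₁ * m)
      · exact hit_low v hv h
      · obtain ⟨i, j, hi, hj, h⟩ := hit_low (m * (2 * n₁) + 1 - v) (by omega) (by omega)
        exact ⟨i, j, hi, hj, by omega⟩
    obtain h | h := h
    · exact ⟨(i, j), ⟨hi, hj.1, by dsimp only; omega⟩, h⟩
    · have := hanti i j hi.1 hi.2 hj.1 (by omega)
      exact ⟨(i, 2 * n₁ + 1 - j), ⟨hi, by dsimp only; omega, by dsimp only; omega⟩, by omega⟩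
  have hinj : Set.InjOn x (Set.Icc 1 m ×ˢ Set.Icc 1 (2 * n₁)) := by
    have := Finset.injOn_of_surjOn_of_card_le (s := Finset.Icc 1 m ×ˢ Finset.Icc 1 (2 * n₁))
      (t := Finset.Icc 1 (m * (2 * n₁))) x (by simpa using hmaps) (by simpa using hsurj) (by simp)
    simpa using this
  refine ⟨_, isC4FaceMagic_of_antisymmetric (by omega) hn₁ rfl ⟨hmaps, hinj, hsurj⟩ hanti ?_ ?_⟩
  · intro i j hi him hj hjn
    obtain ⟨b, hb⟩ := parity j hj
    rw [hmn]
    obtain ⟨a, rfl | rfl⟩ := parity i hi <;> obtain rfl | rfl := hb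
    · have t₁ := e₁ a b (by omega) (by omega)
      have t₂ := e₂ a b (by omega) (by omega)
      have t₃ := e₃ a b (by omega) (by omega)
      have t₄ := e₄ a b (by omega) (by omega)
      simp only [mul_add, add_assoc, Nat.reduceMul, Nat.reduceAdd] at t₁ t₂ t₃ t₄ ⊢
      omega
    · have t₁ := e₁ a (b + 1) (by omega) (by omega)
      have t₂ := e₂ a (b + 1) (by omega) (by omega)
      have t₃ := e₃ a b (by omega) (by omega)
      have t₄ := e₄ a b (by omega) (by omega)
      simp only [mul_add, add_mul, one_mul, add_assoc, Nat.reduceMul, Nat.reduceAdd] at t₁ t₂ t₃ t₄ ⊢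
      omega
    · have t₁ := e₁ (a + 1) b (by omega) (by omega)
      have t₂ := e₂ a b (by omega) (by omega)
      have t₃ := e₃ (a + 1) b (by omega) (by omega)
      have t₄ := e₄ a b (by omega) (by omega)
      simp only [mul_add, add_assoc, Nat.reduceMul, Nat.reduceAdd] at t₁ t₂ t₃ t₄ ⊢
      omega
    · have t₁ := e₁ (a + 1) (b + 1) (by omega) (by omega)
      have t₂ := e₂ a (b + 1) (by omega) (by omega)
      have t₃ := e₃ (a + 1) b (by omega) (by omega)
      have t₄ := e₄ a b (by omega) (by omega)
      simp only [mul_add, add_mul, one_mul, add_assoc, Nat.reduceMul, Nat.reduceAdd] at t₁ t₂ t₃ t₄ ⊢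
      omega
  · intro j hj hjn
    obtain ⟨b, rfl | rfl⟩ := parity j hj
    · have t₁ := e₁ 0 b (by omega) (by omega)
      have t₂ := e₁ k b (by omega) (by omega)
      have t₃ := e₃ 0 b (by omega) (by omega)
      have t₄ := e₃ k b (by omega) (by omega)
      rw [← hk] at t₂ t₄
      simp only [add_assoc, mul_zero, zero_add, Nat.reduceAdd] at t₁ t₂ t₃ t₄ ⊢
      omega
    · have t₁ := e₁ 0 (b + 1) (by omega) (by omega)
      have t₂ := e₁ k (b + 1) (by omega) (by omega)
      have t₃ := e₃ 0 b (by omega) (by omega)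
      have t₄ := e₃ k b (by omega) (by omega)
      rw [← hk] at t₂ t₄
      simp only [mul_add, add_mul, one_mul, add_assoc, mul_zero, zero_add, Nat.reduceMul, Nat.reduceAdd] at t₁ t₂ t₃ t₄ ⊢
      omega
end

section
/- Let m ≥ 2 and n = 2n₁ be even positive integers. Define x on {1,…,m}×{1,…,n} by: x_{2i−1,2j−1} = 2m(j−1) + i for 1 ≤ i ≤ m/2 and 1 ≤ j ≤ ⌊(n₁+1)/2⌋; x_{2i−1,2j} = 2mj + 1 − i for 1 ≤ i ≤ m/2 and 1 ≤ j ≤ ⌊n₁/2⌋; x_{2i−1,2j−1} = m(n+1−2j) + i for 1 ≤ i ≤ m/2 and ⌊(n₁+1)/2⌋ + 1 ≤ j ≤ n₁; x_{2i−1,2j} = m(n+1−2j) + 1 − i for 1 ≤ i ≤ m/2 and ⌊n₁/2⌋ + 1 ≤ j ≤ n₁; and x_{2i,j} = mn + 1 − x_{2i−1,j} for 1 ≤ i ≤ m/2 and 1 ≤ j ≤ n. Then x is a C₄-face-magic Klein bottle labeling on 𝒦_{m,n}. -/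
/-- The successor of a column `j` in the cyclic order on `{1, …, n}`, for even `n`. -/
theorem wrap_succ_of_even {n j : ℕ} (hn : Even n) (h1 : 1 ≤ j) (hj : j ≤ n) :
    1 ≤ wrap n (j + 1) ∧ wrap n (j + 1) ≤ n ∧ wrap n (j + 1) % 2 ≠ j % 2 ∧
      wrap n (n - j) = n + 1 - wrap n (j + 1) := by
  obtain ⟨p, rfl⟩ := hn
  unfold wrap
  obtain rfl | hlt := eq_or_lt_of_le hj
  · have : (p + p + 1) % (p + p) = 1 := by
      rw [Nat.add_mod_left, Nat.mod_eq_of_lt (by omega)]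
    simp only [this, Nat.sub_self, Nat.zero_mod, if_true]
    simp only [one_ne_zero, if_false]
    omega
  · rw [Nat.mod_eq_of_lt (by omega : p + p - j < p + p), if_neg (by omega : p + p - j ≠ 0)]
    obtain he | hl := eq_or_lt_of_le (Nat.succ_le_of_lt hlt)
    · have : (j + 1) % (p + p) = 0 := by rw [← he, Nat.succ_eq_add_one, Nat.mod_self]
      simp only [this, if_true]
      omega
    · rw [Nat.mod_eq_of_lt hl, if_neg (by omega)]
      omega

/-- Uniqueness of division with remainder in `{1, …, m}`. -/
theorem mul_add_inj_of_pos_le {m c c' r r' : ℕ} (hr : 1 ≤ r) (hrm : r ≤ m) (hr' : 1 ≤ r')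
    (hrm' : r' ≤ m) (h : m * c + r = m * c' + r') : c = c' ∧ r = r' := by
  have hc : c = c' := by
    rcases lt_trichotomy c c' with hlt | heq | hlt
    · nlinarith [Nat.mul_le_mul_left m (Nat.succ_le_of_lt hlt)]
    · exact heq
    · nlinarith [Nat.mul_le_mul_left m (Nat.succ_le_of_lt hlt)]
  subst hc
  exact ⟨rfl, by omega⟩

/-- The explicit construction of a C₄-face-magic Klein bottle labeling on
`𝒦_{m,n}` for `m ≥ 2` even and `n = 2n₁` even. -/
theorem kleinBottle_construction_even (m n n₁ : ℕ) (hm : 2 ≤ m) (hme : Even m)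
    (hn₁ : 0 < n₁) (hn : n = 2 * n₁) (x : ℕ × ℕ → ℕ)
    (h1 : ∀ i j, 1 ≤ i → i ≤ m / 2 → 1 ≤ j → j ≤ (n₁ + 1) / 2 →
      x (2 * i - 1, 2 * j - 1) = 2 * m * (j - 1) + i)
    (h2 : ∀ i j, 1 ≤ i → i ≤ m / 2 → 1 ≤ j → j ≤ n₁ / 2 →
      x (2 * i - 1, 2 * j) = 2 * m * j + 1 - i)
    (h3 : ∀ i j, 1 ≤ i → i ≤ m / 2 → (n₁ + 1) / 2 + 1 ≤ j → j ≤ n₁ →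
      x (2 * i - 1, 2 * j - 1) = m * (n + 1 - 2 * j) + i)
    (h4 : ∀ i j, 1 ≤ i → i ≤ m / 2 → n₁ / 2 + 1 ≤ j → j ≤ n₁ →
      x (2 * i - 1, 2 * j) = m * (n + 1 - 2 * j) + 1 - i)
    (h5 : ∀ i j, 1 ≤ i → i ≤ m / 2 → 1 ≤ j → j ≤ n →
      x (2 * i, j) = m * n + 1 - x (2 * i - 1, j)) :
    ∃ S, IsC4FaceMagic m n x S := by
  obtain ⟨p, rfl⟩ := hme
  have hp : (p + p) / 2 = p := by omega
  rw [hp] at h1 h2 h3 h4 h5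
  have hodd : ∀ i k, 1 ≤ i → i ≤ p → 1 ≤ k → k ≤ n → x (2 * i - 1, k) =
      (p + p) * min (k - 1) (n - k) + if k % 2 = 1 then i else p + p + 1 - i := by
    intro i k hi hip hk hkn
    obtain ⟨j, rfl | rfl⟩ : ∃ j, k = 2 * j - 1 ∨ k = 2 * j := ⟨(k + 1) / 2, by omega⟩
    · rw [if_pos (by omega)]
      rcases le_or_gt j ((n₁ + 1) / 2) with hj | hj
      · rw [h1 i j hi hip (by omega) hj,
          show min (2 * j - 1 - 1) (n - (2 * j - 1)) = 2 * (j - 1) by omega]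
        ring
      · rw [h3 i j hi hip hj (by omega),
          show min (2 * j - 1 - 1) (n - (2 * j - 1)) = n + 1 - 2 * j by omega]
    · rw [if_neg (by omega)]
      rcases le_or_gt j (n₁ / 2) with hj | hj
      · rw [h2 i j hi hip (by omega) hj]
        obtain ⟨d, hd⟩ : ∃ d, 2 * j = d + 1 := ⟨2 * j - 1, by omega⟩
        rw [show min (2 * j - 1) (n - 2 * j) = d by omega,
          show 2 * (p + p) * j = (p + p) * d + (p + p) by
            rw [mul_comm 2, mul_assoc, hd]; ring]
        omega
      · rw [h4 i j hi hip hj (by omega), show min (2 * j - 1) (n - 2 * j) = n - 2 * j by omega,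
          show n + 1 - 2 * j = (n - 2 * j) + 1 by omega, mul_add, mul_one]
        omega
  have hrem : ∀ i k, 1 ≤ i → i ≤ p → 1 ≤ (if k % 2 = 1 then i else p + p + 1 - i) ∧
      (if k % 2 = 1 then i else p + p + 1 - i) ≤ p + p := by
    intro i k hi hip
    split_ifs <;> omega
  have hmn : (p + p) * n = (p + p) * n₁ + (p + p) * n₁ := by rw [hn]; ring
  have hbound : ∀ i k, 1 ≤ i → i ≤ p → 1 ≤ k → k ≤ n →
      1 ≤ x (2 * i - 1, k) ∧ x (2 * i - 1, k) ≤ (p + p) * n₁ := by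
    intro i k hi hip hk hkn
    rw [hodd i k hi hip hk hkn]
    have hc : min (k - 1) (n - k) + 1 ≤ n₁ := by omega
    have hmul := Nat.mul_le_mul_left (p + p) hc
    rw [mul_add, mul_one] at hmul
    have := hrem i k hi hip
    omega
  have hinj : ∀ i k i' k', 1 ≤ i → i ≤ p → 1 ≤ k → k ≤ n → 1 ≤ i' → i' ≤ p → 1 ≤ k' →
      k' ≤ n → x (2 * i - 1, k) = x (2 * i' - 1, k') → i = i' ∧ k = k' := by
    intro i k i' k' hi hip hk hkn hi' hip' hk' hkn' h
    rw [hodd i k hi hip hk hkn, hodd i' k' hi' hip' hk' hkn'] at h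
    obtain ⟨hc, hr⟩ := mul_add_inj_of_pos_le (hrem i k hi hip).1 (hrem i k hi hip).2
      (hrem i' k' hi' hip').1 (hrem i' k' hi' hip').2 h
    split_ifs at hr <;> omega
  have hrow : ∀ a, 1 ≤ a → a ≤ p + p → ∃ i, 1 ≤ i ∧ i ≤ p ∧ (a = 2 * i - 1 ∨ a = 2 * i) :=
    fun a _ _ => ⟨(a + 1) / 2, by omega⟩
  have hmaps : Set.MapsTo x (Set.Icc 1 (p + p) ×ˢ Set.Icc 1 n) (Set.Icc 1 ((p + p) * n)) := by
    rintro ⟨a, k⟩ ⟨⟨ha, ham⟩, hk, hkn⟩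
    dsimp only at ha ham hk hkn
    obtain ⟨i, hi, hip, rfl | rfl⟩ := hrow a ha ham
    all_goals
      have := hbound i k hi hip hk hkn
      have := h5 i k hi hip hk hkn
      rw [Set.mem_Icc]
      omega
  have hinjOn : Set.InjOn x (Set.Icc 1 (p + p) ×ˢ Set.Icc 1 n) := by
    rintro ⟨a, k⟩ ⟨⟨ha, ham⟩, hk, hkn⟩ ⟨a', k'⟩ ⟨⟨ha', ham'⟩, hk', hkn'⟩ h
    dsimp only at ha ham hk hkn ha' ham' hk' hkn'
    obtain ⟨i, hi, hip, hai⟩ := hrow a ha ham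
    obtain ⟨i', hi', hip', hai'⟩ := hrow a' ha' ham'
    have hb := hbound i k hi hip hk hkn
    have hb' := hbound i' k' hi' hip' hk' hkn'
    have hx := h5 i k hi hip hk hkn
    have hx' := h5 i' k' hi' hip' hk' hkn'
    have hii := hinj i k i' k' hi hip hk hkn hi' hip' hk' hkn'
    rcases hai with rfl | rfl <;> rcases hai' with rfl | rfl
    · obtain ⟨rfl, rfl⟩ := hii h
      rfl
    · omega
    · omega
    · obtain ⟨rfl, rfl⟩ := hii (by omega)
      rfl
  have hsurj : Set.SurjOn x (Set.Icc 1 (p + p) ×ˢ Set.Icc 1 n) (Set.Icc 1 ((p + p) * n)) := by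
    have hs := Finset.surjOn_of_injOn_of_card_le (s := Finset.Icc 1 (p + p) ×ˢ Finset.Icc 1 n)
      (t := Finset.Icc 1 ((p + p) * n)) x (by simpa using hmaps) (by simpa using hinjOn) (by simp)
    simpa using hs
  have hne : Even n := ⟨n₁, by omega⟩
  refine ⟨2 * ((p + p) * n + 1), ⟨hmaps, hinjOn, hsurj⟩, ?_, ?_⟩
  · intro a j ha ham hj hjn
    obtain ⟨hw, hwn, hpar, -⟩ := wrap_succ_of_even hne hj hjn
    set w := wrap n (j + 1)
    obtain ⟨i, hi, hip, rfl | rfl⟩ := hrow a ha (by omega)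
    all_goals
      have hbj := hbound i j hi hip hj hjn
      have hbw := hbound i w hi hip hw hwn
      have hxj := h5 i j hi hip hj hjn
      have hxw := h5 i w hi hip hw hwn
    · rw [show 2 * i - 1 + 1 = 2 * i by omega]
      omega
    · have hj1 := hodd i j hi hip hj hjn
      have hw1 := hodd i w hi hip hw hwn
      have hj2 := hodd (i + 1) j (by omega) (by omega) hj hjn
      have hw2 := hodd (i + 1) w (by omega) (by omega) hw hwn
      rw [show 2 * (i + 1) - 1 = 2 * i + 1 by omega] at hj2 hw2
      split_ifs at hj1 hw1 hj2 hw2 <;> omega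
  · intro j hj hjn
    obtain ⟨hw, hwn, hpar, hrefl⟩ := wrap_succ_of_even hne hj hjn
    rw [hrefl]
    set w := wrap n (j + 1)
    have hcol : ∀ k, 1 ≤ k → k ≤ n → x (p + p, k) + x (1, n + 1 - k) + (if k % 2 = 1 then 0 else p)
        = (p + p) * n + 1 + (if k % 2 = 1 then p else 0) := by
      intro k hk hkn
      have hb := hbound p k (by omega) le_rfl hk hkn
      have hx := h5 p k (by omega) le_rfl hk hkn
      have hk1 := hodd p k (by omega) le_rfl hk hkn
      have hk2 := hodd 1 (n + 1 - k) le_rfl (by omega) (by omega) (by omega)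
      rw [show min (n + 1 - k - 1) (n - (n + 1 - k)) = min (k - 1) (n - k) by omega,
        show 2 * 1 - 1 = 1 by rfl] at hk2
      rw [← two_mul p] at hb hx hk1 hk2 hmn ⊢
      split_ifs at hk1 hk2 ⊢ <;> omega
    have hcj := hcol j hj hjn
    have hcw := hcol w hw hwn
    split_ifs at hcj hcw <;> omega
end

section
/- Let m ≥ 3 be an odd integer. The number of Klein bottle equivalence classes of C₄-face-magic Klein bottle labelings on 𝒦_{m,4} equals 2^m · (m−1)! · τ(m), where τ(m) denotes the number of positive divisors of m. -/
/-- The symmetry `U` of the Klein bottle: `U(i,j) = (i+1,j)` for `1 ≤ i ≤ m-1` and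
`U(m,j) = (1, n+1-j)`. -/
def Umap (m n : ℕ) : ℕ × ℕ → ℕ × ℕ := fun p => if p.1 < m then (p.1 + 1, p.2) else (1, n + 1 - p.2)

/-- The symmetry `H` of the Klein bottle: `H(i,j) = (i, j + n/2)`, second coordinate
taken modulo `n` with representative in `{1,…,n}`. -/
def Hmap (n : ℕ) : ℕ × ℕ → ℕ × ℕ := fun p => (p.1, wrap n (p.2 + n / 2))

/-- The reflection `F` of the Klein bottle: `F(i,j) = (i, n+1-j)`. -/
def Fmap (n : ℕ) : ℕ × ℕ → ℕ × ℕ := fun p => (p.1, n + 1 - p.2)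

/-- Membership in the Klein bottle labeling symmetry group `KBLS(m,n)`, the group of
permutations of `{1,…,m} × {1,…,n}` generated by `U`, `H` and `F`. -/
inductive MemKBLS (m n : ℕ) : (ℕ × ℕ → ℕ × ℕ) → Prop
  | one : MemKBLS m n id
  | genU : MemKBLS m n (Umap m n)
  | genH : MemKBLS m n (Hmap n)
  | genF : MemKBLS m n (Fmap n)
  | comp {f g : ℕ × ℕ → ℕ × ℕ} : MemKBLS m n f → MemKBLS m n g → MemKBLS m n (f ∘ g)

/-- Two labelings of `𝒦_{m,n}` are Klein bottle equivalent if one is obtained from the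
other by composing with a member of `KBLS(m,n)`. -/
def KBEquiv (m n : ℕ) (x y : ℕ × ℕ → ℕ) : Prop :=
  ∃ A, MemKBLS m n A ∧ ∀ p ∈ Set.Icc 1 m ×ˢ Set.Icc 1 n, y p = x (A p)

/-- Lists of length `k` of elements of `E` in which no entry equals an earlier entry or the
`σ`-image of an earlier entry. -/
def transversals (σ : ℕ → ℕ) : ℕ → Finset ℕ → Finset (List ℕ)
  | 0, _ => {[]}
  | k + 1, E => E.biUnion fun e => (transversals σ k (E \ {e, σ e})).image (List.cons e)

theorem cons_mem_transversals {σ : ℕ → ℕ} {k : ℕ} {E : Finset ℕ} {e : ℕ} {l : List ℕ} :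
    e :: l ∈ transversals σ (k + 1) E ↔ e ∈ E ∧ l ∈ transversals σ k (E \ {e, σ e}) := by
  simp [transversals]

theorem mem_transversals {σ : ℕ → ℕ} {k : ℕ} {E : Finset ℕ} {l : List ℕ} :
    l ∈ transversals σ k E ↔
      l.length = k ∧ (∀ y ∈ l, y ∈ E) ∧ l.Pairwise (fun a b => b ≠ a ∧ b ≠ σ a) := by
  induction k generalizing E l with
  | zero =>
    cases l <;> simp [transversals]
  | succ k ih =>
    cases l with
    | nil => simp [transversals]
    | cons e l =>
      rw [cons_mem_transversals, ih]
      simp only [Finset.mem_sdiff, Finset.mem_insert, Finset.mem_singleton, List.length_cons,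
        List.mem_cons, List.pairwise_cons]
      constructor
      · rintro ⟨he, hl, hm, hp⟩
        refine ⟨by omega, ?_, ?_, hp⟩
        · rintro y (rfl | hy)
          · exact he
          · exact (hm y hy).1
        · intro y hy
          have := (hm y hy).2
          tauto
      · rintro ⟨hl, hm, hq, hp⟩
        refine ⟨hm e (Or.inl rfl), by omega, ?_, hp⟩
        intro y hy
        have := hq y hy
        exact ⟨hm y (Or.inr hy), by tauto⟩

theorem card_transversals {σ : ℕ → ℕ} {k : ℕ} {E : Finset ℕ} (hE : E.card = 2 * k)
    (hmaps : ∀ y ∈ E, σ y ∈ E) (hinv : ∀ y ∈ E, σ (σ y) = y) (hfix : ∀ y ∈ E, σ y ≠ y) :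
    (transversals σ k E).card = 2 ^ k * k.factorial := by
  induction k generalizing E with
  | zero => simp [transversals]
  | succ k ih =>
    rw [transversals, Finset.card_biUnion]
    · have : ∀ e ∈ E, ((transversals σ k (E \ {e, σ e})).image (List.cons e)).card
          = 2 ^ k * k.factorial := by
        intro e he
        rw [Finset.card_image_of_injective _ (List.cons_injective)]
        apply ih
        · rw [Finset.card_sdiff_of_subset, Finset.card_pair (hfix e he).symm, hE]
          · omega
          · intro y hy
            simp only [Finset.mem_insert, Finset.mem_singleton] at hy
            rcases hy with rfl | rfl
            · exact he
            · exact hmaps _ he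
        · intro y hy
          simp only [Finset.mem_sdiff, Finset.mem_insert, Finset.mem_singleton, not_or] at hy ⊢
          refine ⟨hmaps y hy.1, fun h => hy.2.2 ?_, fun h => hy.2.1 ?_⟩
          · rw [← h, hinv y hy.1]
          · rw [← hinv y hy.1, h, hinv e he]
        · intro y hy
          exact hinv y (Finset.mem_sdiff.1 hy).1
        · intro y hy
          exact hfix y (Finset.mem_sdiff.1 hy).1
      rw [Finset.sum_congr rfl this, Finset.sum_const, hE, Nat.factorial_succ, smul_eq_mul]
      ring
    · intro a _ b _ hab
      rw [Function.onFun, Finset.disjoint_left]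
      intro l h1 h2
      simp only [Finset.mem_image] at h1 h2
      obtain ⟨l1, _, rfl⟩ := h1
      obtain ⟨l2, _, h⟩ := h2
      exact hab (List.cons.inj h).1.symm

/-- The union of the even-numbered blocks when `{1, …, 4 * m}` is cut into blocks of
length `d`. -/
def evenBlocks (m d : ℕ) : Finset ℕ := {y ∈ Finset.Icc 1 (4 * m) | (y - 1) / d % 2 = 0}

theorem mem_evenBlocks {m d y : ℕ} :
    y ∈ evenBlocks m d ↔ (1 ≤ y ∧ y ≤ 4 * m) ∧ (y - 1) / d % 2 = 0 := by
  simp [evenBlocks]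

theorem div_add_div_reflect {m d q y : ℕ} (hd : 0 < d) (hq : d * q = 2 * m) (h1 : 1 ≤ y)
    (h2 : y ≤ 4 * m) : (4 * m - y) / d + (y - 1) / d + 1 = 2 * q := by
  have h := Nat.mul_sub_div (y - 1) d (2 * q) (by nlinarith [Nat.sub_add_cancel h1])
  have e : d * (2 * q) = 4 * m := by linarith
  rw [e, Nat.sub_add_cancel h1] at h
  have : (y - 1) / d < 2 * q := by
    rw [Nat.div_lt_iff_lt_mul hd]
    have : 2 * q * d = 4 * m := by linarith
    omega
  omega

theorem reflect_mem_evenBlocks {m d y : ℕ} (hd : 0 < d) (hdm : d ∣ 2 * m) (h1 : 1 ≤ y)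
    (h2 : y ≤ 4 * m) : 4 * m + 1 - y ∈ evenBlocks m d ↔ y ∉ evenBlocks m d := by
  obtain ⟨q, hq⟩ := hdm
  have h := div_add_div_reflect hd hq.symm h1 h2
  rw [mem_evenBlocks, mem_evenBlocks, show 4 * m + 1 - y - 1 = 4 * m - y by omega]
  omega

theorem shift_not_mem_evenBlocks {m d y : ℕ} (hd : 0 < d) (hdm : d ∣ 2 * m)
    (h : y ∈ evenBlocks m d) : y + d ≤ 4 * m ∧ y + d ∉ evenBlocks m d := by
  obtain ⟨q, hq⟩ := hdm
  rw [mem_evenBlocks] at h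
  have hs : (y + d - 1) / d = (y - 1) / d + 1 := by
    rw [show y + d - 1 = (y - 1) + d by omega, Nat.add_div_right _ hd]
  have h2 := div_add_div_reflect hd hq.symm h.1.1 h.1.2
  have h3 : 0 < (4 * m - y) / d := by
    have h5 := h.2
    generalize (y - 1) / d = b at h2 h5
    generalize (4 * m - y) / d = c at h2 ⊢
    omega
  have h4 : d ≤ 4 * m - y := by
    by_contra hlt
    rw [Nat.div_eq_of_lt (by omega)] at h3
    omega
  refine ⟨by omega, ?_⟩
  rw [mem_evenBlocks, hs]
  omega

theorem partner_mem_evenBlocks {m d y : ℕ} (hd : 0 < d) (hdm : d ∣ 2 * m)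
    (h : y ∈ evenBlocks m d) : 4 * m + 1 - d - y ∈ evenBlocks m d := by
  have hy := (mem_evenBlocks.1 h).1
  have hs := shift_not_mem_evenBlocks hd hdm h
  have := (reflect_mem_evenBlocks hd hdm (by omega) hs.1).2 hs.2
  rwa [show 4 * m + 1 - (y + d) = 4 * m + 1 - d - y by omega] at this

theorem partner_ne {m d y : ℕ} (hd : 0 < d) (hdm : d ∣ 2 * m)
    (h : y ∈ evenBlocks m d) : 4 * m + 1 - d - y ≠ y := by
  intro he
  have hy := mem_evenBlocks.1 h
  have hs := shift_not_mem_evenBlocks hd hdm h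
  obtain ⟨q, hq⟩ := hdm
  have h2 := div_add_div_reflect hd hq.symm hy.1.1 hy.1.2
  have h3 : (4 * m - y) / d = (y - 1) / d + 1 := by
    rw [show 4 * m - y = (y - 1) + d by omega, Nat.add_div_right _ hd]
  have hqo : q % 2 = 1 := by omega
  have hdo : d % 2 = 1 := by omega
  have : (d * q) % 2 = 1 := by rw [Nat.mul_mod, hqo, hdo]
  omega

theorem card_evenBlocks {m d : ℕ} (hd : 0 < d) (hdm : d ∣ 2 * m) :
    (evenBlocks m d).card = 2 * m := by
  have hsub : evenBlocks m d ⊆ Finset.Icc 1 (4 * m) := Finset.filter_subset _ _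
  have h1 := Finset.card_sdiff_add_card_eq_card hsub
  have h2 : (evenBlocks m d).card = (Finset.Icc 1 (4 * m) \ evenBlocks m d).card := by
    apply Finset.card_bij' (fun y _ => 4 * m + 1 - y) (fun y _ => 4 * m + 1 - y)
    · intro y hy
      have hy' := (mem_evenBlocks.1 hy).1
      rw [Finset.mem_sdiff, reflect_mem_evenBlocks hd hdm hy'.1 hy'.2, Finset.mem_Icc]
      exact ⟨by omega, not_not.2 hy⟩
    · intro y hy
      rw [Finset.mem_sdiff, Finset.mem_Icc] at hy
      rw [reflect_mem_evenBlocks hd hdm hy.1.1 hy.1.2]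
      exact hy.2
    · intro y hy
      have hy' := (mem_evenBlocks.1 hy).1
      omega
    · intro y hy
      rw [Finset.mem_sdiff, Finset.mem_Icc] at hy
      omega
  rw [Nat.card_Icc] at h1
  omega

/-- A set which is exchanged with its complement in `{1, …, 4 * m}` by translation by `d` is
the union of the even-numbered blocks of length `d`. -/
theorem eq_evenBlocks_of_shift {m d : ℕ} {W : ℕ → Prop} (hd : 0 < d) (hm : d ≤ 4 * m)
    (hW : ∀ y, W y → 1 ≤ y ∧ y + d ≤ 4 * m ∧ ¬ W (y + d))
    (hW' : ∀ y, 1 ≤ y → y ≤ 4 * m → ¬ W y → d < y ∧ W (y - d)) :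
    d ∣ 2 * m ∧ ∀ y, W y ↔ y ∈ evenBlocks m d := by
  have key : ∀ y, 1 ≤ y → y ≤ 4 * m → (W y ↔ (y - 1) / d % 2 = 0) := by
    intro y
    induction y using Nat.strong_induction_on with
    | _ y ih =>
      intro h1 h2
      by_cases hyd : y ≤ d
      · rw [Nat.div_eq_of_lt (by omega)]
        have : W y := by
          by_contra h
          have := (hW' y h1 h2 h).1
          omega
        simpa using this
      · have hi := ih (y - d) (by omega) (by omega) (by omega)
        have e : (y - 1) / d = (y - d - 1) / d + 1 := by
          rw [show y - 1 = (y - d - 1) + d by omega, Nat.add_div_right _ hd]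
        rw [e]
        have h3 : W y ↔ ¬ W (y - d) := by
          constructor
          · intro h h'
            have := (hW _ h').2.2
            rw [Nat.sub_add_cancel (by omega)] at this
            exact this h
          · intro h
            by_contra h'
            exact h (hW' y h1 h2 h').2
        rw [h3, hi]
        omega
  have last : ∀ y, 1 ≤ y → y ≤ 4 * m → 4 * m < y + d → (y - 1) / d % 2 = 1 := by
    intro y h1 h2 h3
    have : ¬ W y := fun h => by
      have := (hW y h).2.1
      omega
    rw [key y h1 h2] at this
    omega
  refine ⟨?_, fun y => ?_⟩
  · have hdm := Nat.div_add_mod (4 * m) d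
    have hlt := Nat.mod_lt (4 * m) hd
    set q := 4 * m / d with hq
    set r := 4 * m % d with hr
    have hqpos : 1 ≤ q := (Nat.one_le_div_iff hd).2 hm
    obtain ⟨p, hp⟩ : ∃ p, q = p + 1 := ⟨q - 1, by omega⟩
    have hdq : d * q = d * p + d := by rw [hp]; ring
    have e1 : (d * q - 1) / d = p := by
      rw [show d * q - 1 = (d - 1) + d * p by omega, Nat.add_mul_div_left _ _ hd,
        Nat.div_eq_of_lt (by omega)]
      omega
    have l1 := last (d * q) (by omega) (by omega) (by omega)
    rw [e1] at l1
    have hr0 : r = 0 := by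
      by_contra hne
      have e2 : (4 * m - 1) / d = q := by
        rw [show 4 * m - 1 = (r - 1) + d * q by omega, Nat.add_mul_div_left _ _ hd,
          Nat.div_eq_of_lt (by omega)]
        omega
      have l2 := last (4 * m) (by omega) (by omega) (by omega)
      rw [e2] at l2
      omega
    obtain ⟨t, ht⟩ : ∃ t, q = 2 * t := ⟨q / 2, by omega⟩
    refine ⟨t, ?_⟩
    have : d * q = 2 * (d * t) := by rw [ht]; ring
    omega
  · rw [mem_evenBlocks]
    constructor
    · intro h
      have h' := hW y h
      have hb : 1 ≤ y ∧ y ≤ 4 * m := ⟨h'.1, by omega⟩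
      exact ⟨hb, (key y hb.1 hb.2).1 h⟩
    · rintro ⟨hb, h⟩
      exact (key y hb.1 hb.2).2 h

/-- The vertex set of `𝒦_{m,4}`. -/
def grid (m : ℕ) : Set (ℕ × ℕ) := Set.Icc 1 m ×ˢ Set.Icc 1 4

theorem mem_grid {m : ℕ} {p : ℕ × ℕ} :
    p ∈ grid m ↔ (1 ≤ p.1 ∧ p.1 ≤ m) ∧ 1 ≤ p.2 ∧ p.2 ≤ 4 := by
  simp only [grid, Set.mem_prod, Set.mem_Icc]

theorem wrap_four (j : ℕ) : wrap 4 j = if j % 4 = 0 then 4 else j % 4 := rfl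

theorem Umap_iterate {m i j : ℕ} (hp : (i, j) ∈ grid m) :
    ∀ k, k ≤ m → (Umap m 4)^[k] (i, j) =
      if i + k ≤ m then (i + k, j) else (i + k - m, 5 - j) := by
  rw [mem_grid] at hp
  simp only at hp
  intro k
  induction k with
  | zero => intro _; simp [hp.1.2]
  | succ k ih =>
    intro hk
    rw [Function.iterate_succ_apply', ih (by omega)]
    rcases lt_trichotomy (i + k) m with h | h | h
    · rw [if_pos h.le, if_pos (by omega), Umap, if_pos h]
      rfl
    · rw [if_pos h.le, if_neg (by omega), Umap, if_neg (by simp only; omega)]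
      ext <;> lia
    · rw [if_neg (by omega), if_neg (by omega), Umap, if_pos (by simp only; omega)]
      ext <;> lia

theorem MemKBLS.iterate {m n : ℕ} {f : ℕ × ℕ → ℕ × ℕ} (hf : MemKBLS m n f) (k : ℕ) :
    MemKBLS m n f^[k] := by
  induction k with
  | zero => exact .one
  | succ k ih => exact .comp ih hf

theorem MemKBLS.mapsTo {m : ℕ} {f : ℕ × ℕ → ℕ × ℕ} (hf : MemKBLS m 4 f) :
    Set.MapsTo f (grid m) (grid m) := by
  induction hf with
  | one => exact Set.mapsTo_id _
  | genU =>
    intro p hp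
    rw [mem_grid] at hp ⊢
    unfold Umap
    split_ifs <;> simp only <;> omega
  | genH =>
    intro p hp
    rw [mem_grid] at hp ⊢
    simp only [Hmap, wrap_four]
    split_ifs <;> omega
  | genF =>
    intro p hp
    rw [mem_grid] at hp ⊢
    simp only [Fmap]
    omega
  | comp _ _ ih1 ih2 => exact ih1.comp ih2

theorem MemKBLS.exists_inverse {m : ℕ} (hm : 1 ≤ m) {f : ℕ × ℕ → ℕ × ℕ} (hf : MemKBLS m 4 f) :
    ∃ g, MemKBLS m 4 g ∧ (∀ p ∈ grid m, g (f p) = p) ∧ ∀ p ∈ grid m, f (g p) = p := by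
  induction hf with
  | one => exact ⟨id, .one, fun _ _ => rfl, fun _ _ => rfl⟩
  | genU =>
    have hinv : ∀ p ∈ grid m, ((Umap m 4)^[m - 1] ∘ Fmap 4) p =
        if 1 < p.1 then (p.1 - 1, p.2) else (m, 5 - p.2) := by
      rintro ⟨i, j⟩ hp
      have hF : (i, 5 - j) ∈ grid m := MemKBLS.genF.mapsTo hp
      rw [Function.comp_apply, Fmap, Umap_iterate hF _ (by omega)]
      rw [mem_grid] at hp
      simp only at hp ⊢
      split_ifs <;> ext <;> lia
    refine ⟨(Umap m 4)^[m - 1] ∘ Fmap 4, .comp (MemKBLS.genU.iterate _) .genF, ?_, ?_⟩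
    · rintro ⟨i, j⟩ hp
      rw [hinv _ (MemKBLS.genU.mapsTo hp)]
      rw [mem_grid] at hp
      simp only at hp
      rcases Nat.lt_or_ge i m with h | h
      · simp [Umap, h, show 0 < i by omega]
      · simp only [Umap, h.not_gt, if_false, lt_irrefl]
        ext <;> lia
    · rintro ⟨i, j⟩ hp
      rw [hinv _ hp]
      rw [mem_grid] at hp
      simp only at hp
      rcases Nat.lt_or_ge 1 i with h | h
      · simp only [Umap, h, if_true, show i - 1 < m by omega]
        ext <;> lia
      · simp only [Umap, h.not_gt, if_false, lt_irrefl]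
        ext <;> lia
  | genH =>
    have h : ∀ p ∈ grid m, Hmap 4 (Hmap 4 p) = p := by
      rintro ⟨i, j⟩ hp
      obtain ⟨-, h1, h4⟩ := mem_grid.1 hp
      simp only at h1 h4
      interval_cases j <;> simp [Hmap, wrap_four]
    exact ⟨Hmap 4, .genH, h, h⟩
  | genF =>
    have h : ∀ p ∈ grid m, Fmap 4 (Fmap 4 p) = p := by
      intro p hp
      rw [mem_grid] at hp
      simp only [Fmap]
      ext <;> simp only
      omega
    exact ⟨Fmap 4, .genF, h, h⟩
  | @comp f1 f2 h1 h2 ih1 ih2 =>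
    obtain ⟨g1, hg1, l1, r1⟩ := ih1
    obtain ⟨g2, hg2, l2, r2⟩ := ih2
    refine ⟨g2 ∘ g1, .comp hg2 hg1, fun p hp => ?_, fun p hp => ?_⟩
    · simp only [Function.comp_apply]
      rw [l1 _ (h2.mapsTo hp), l2 _ hp]
    · simp only [Function.comp_apply]
      rw [r2 _ (hg1.mapsTo hp), r1 _ hp]

theorem MemKBLS.bijOn {m : ℕ} (hm : 1 ≤ m) {f : ℕ × ℕ → ℕ × ℕ} (hf : MemKBLS m 4 f) :
    Set.BijOn f (grid m) (grid m) := by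
  obtain ⟨g, hg, l, r⟩ := hf.exists_inverse hm
  exact Set.InvOn.bijOn ⟨l, r⟩ hf.mapsTo hg.mapsTo

theorem Umap_Hmap_comm {m : ℕ} {p : ℕ × ℕ} (hp : p ∈ grid m) :
    Umap m 4 (Hmap 4 p) = Hmap 4 (Umap m 4 p) := by
  obtain ⟨i, j⟩ := p
  obtain ⟨-, h1, h4⟩ := mem_grid.1 hp
  simp only at h1 h4
  by_cases h : i < m <;> interval_cases j <;> simp [Umap, Hmap, wrap_four, h]

theorem Umap_Fmap_comm {m : ℕ} (p : ℕ × ℕ) : Umap m 4 (Fmap 4 p) = Fmap 4 (Umap m 4 p) := by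
  by_cases h : p.1 < m <;> simp [Umap, Fmap, h]

theorem Hmap_Fmap_comm {m : ℕ} {p : ℕ × ℕ} (hp : p ∈ grid m) :
    Hmap 4 (Fmap 4 p) = Fmap 4 (Hmap 4 p) := by
  obtain ⟨i, j⟩ := p
  obtain ⟨-, h1, h4⟩ := mem_grid.1 hp
  simp only at h1 h4
  interval_cases j <;> simp [Fmap, Hmap, wrap_four]

theorem MemKBLS.comm {m : ℕ} {f g : ℕ × ℕ → ℕ × ℕ} (hf : MemKBLS m 4 f) (hg : MemKBLS m 4 g) :
    ∀ p ∈ grid m, f (g p) = g (f p) := by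
  induction hf with
  | one => exact fun _ _ => rfl
  | comp h1 h2 ih1 ih2 =>
    intro p hp
    simp only [Function.comp_apply]
    rw [ih2 p hp, ih1 _ (h2.mapsTo hp)]
  | genU =>
    induction hg with
    | one => exact fun _ _ => rfl
    | comp h1 h2 ih1 ih2 =>
      intro p hp
      simp only [Function.comp_apply]
      rw [ih1 _ (h2.mapsTo hp), ih2 p hp]
    | genU => exact fun _ _ => rfl
    | genH => exact fun p hp => Umap_Hmap_comm hp
    | genF => exact fun p _ => Umap_Fmap_comm p
  | genH =>
    induction hg with
    | one => exact fun _ _ => rfl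
    | comp h1 h2 ih1 ih2 =>
      intro p hp
      simp only [Function.comp_apply]
      rw [ih1 _ (h2.mapsTo hp), ih2 p hp]
    | genU => exact fun p hp => (Umap_Hmap_comm hp).symm
    | genH => exact fun _ _ => rfl
    | genF => exact fun p hp => Hmap_Fmap_comm hp
  | genF =>
    induction hg with
    | one => exact fun _ _ => rfl
    | comp h1 h2 ih1 ih2 =>
      intro p hp
      simp only [Function.comp_apply]
      rw [ih1 _ (h2.mapsTo hp), ih2 p hp]
    | genU => exact fun p _ => (Umap_Fmap_comm p).symm
    | genH => exact fun p hp => (Hmap_Fmap_comm hp).symm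
    | genF => exact fun _ _ => rfl

theorem exists_memKBLS_apply_eq {m : ℕ} {p : ℕ × ℕ} (hp : p ∈ grid m) :
    ∃ f, MemKBLS m 4 f ∧ f (1, 1) = p := by
  obtain ⟨i, j⟩ := p
  rw [mem_grid] at hp
  simp only at hp
  obtain ⟨g, hg, hgj⟩ : ∃ g, MemKBLS m 4 g ∧ g (1, 1) = (1, j) := by
    obtain ⟨-, h1, h4⟩ := hp
    interval_cases j
    · exact ⟨id, .one, rfl⟩
    · exact ⟨Hmap 4 ∘ Fmap 4, .comp .genH .genF, rfl⟩
    · exact ⟨Hmap 4, .genH, rfl⟩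
    · exact ⟨Fmap 4, .genF, rfl⟩
  refine ⟨(Umap m 4)^[i - 1] ∘ g, .comp (MemKBLS.genU.iterate _) hg, ?_⟩
  rw [Function.comp_apply, hgj, Umap_iterate (mem_grid.2 (by simp only; omega)) _ (by omega),
    if_pos (by omega)]
  ext <;> lia

theorem MemKBLS.eq_of_fixes {m : ℕ} (hm : 1 ≤ m) {f : ℕ × ℕ → ℕ × ℕ} (hf : MemKBLS m 4 f)
    (h : f (1, 1) = (1, 1)) : ∀ p ∈ grid m, f p = p := by
  intro p hp
  obtain ⟨g, hg, rfl⟩ := exists_memKBLS_apply_eq hp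
  rw [hf.comm hg _ (mem_grid.2 (by simp only; omega)), h]

/-- The face conditions of `IsC4FaceMagic m 4` for all faces between consecutive rows and
across the seam, written out column by column. -/
theorem isC4FaceMagic_four_iff {m : ℕ} {x : ℕ × ℕ → ℕ} {S : ℕ} :
    IsC4FaceMagic m 4 x S ↔ Set.BijOn x (grid m) (Set.Icc 1 (m * 4)) ∧
      (∀ i, 1 ≤ i → i + 1 ≤ m →
        x (i, 1) + x (i + 1, 1) + x (i, 2) + x (i + 1, 2) = S ∧
        x (i, 2) + x (i + 1, 2) + x (i, 3) + x (i + 1, 3) = S ∧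
        x (i, 3) + x (i + 1, 3) + x (i, 4) + x (i + 1, 4) = S ∧
        x (i, 4) + x (i + 1, 4) + x (i, 1) + x (i + 1, 1) = S) ∧
      x (m, 1) + x (m, 2) + x (1, 4) + x (1, 3) = S ∧
      x (m, 2) + x (m, 3) + x (1, 3) + x (1, 2) = S ∧
      x (m, 3) + x (m, 4) + x (1, 2) + x (1, 1) = S ∧
      x (m, 4) + x (m, 1) + x (1, 1) + x (1, 4) = S := by
  unfold IsC4FaceMagic
  refine and_congr Iff.rfl (and_congr ?_ ?_)
  · constructor
    · intro h i h1 h2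
      exact ⟨h i 1 h1 h2 (by norm_num) (by norm_num), h i 2 h1 h2 (by norm_num) (by norm_num),
        h i 3 h1 h2 (by norm_num) (by norm_num), h i 4 h1 h2 (by norm_num) (by norm_num)⟩
    · intro h i j h1 h2 h3 h4
      obtain ⟨a, b, c, e⟩ := h i h1 h2
      interval_cases j
      exacts [a, b, c, e]
  · constructor
    · intro h
      exact ⟨h 1 (by norm_num) (by norm_num), h 2 (by norm_num) (by norm_num),
        h 3 (by norm_num) (by norm_num), h 4 (by norm_num) (by norm_num)⟩
    · rintro ⟨a, b, c, e⟩ j h3 h4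
      interval_cases j
      exacts [a, b, c, e]

theorem IsC4FaceMagic.comp_memKBLS {m : ℕ} (hm : 2 ≤ m) {f : ℕ × ℕ → ℕ × ℕ}
    (hf : MemKBLS m 4 f) :
    ∀ {x : ℕ × ℕ → ℕ} {S : ℕ}, IsC4FaceMagic m 4 x S → IsC4FaceMagic m 4 (x ∘ f) S := by
  induction hf with
  | one => exact fun h => h
  | comp h1 h2 ih1 ih2 => exact fun h => ih2 (ih1 h)
  | genU =>
    intro x S h
    rw [isC4FaceMagic_four_iff] at h ⊢
    obtain ⟨hb, hf, s1, s2, s3, s4⟩ := h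
    refine ⟨hb.comp (MemKBLS.genU.bijOn (by omega)), ?_, ?_⟩
    · intro i h1 h2
      rcases Nat.lt_or_ge (i + 1) m with h | h
      · have := hf (i + 1) (by omega) (by omega)
        simpa [Umap, h, show i < m by omega] using this
      · obtain rfl : m = i + 1 := by omega
        simp only [Umap, Function.comp_apply, lt_irrefl, if_false, Nat.lt_succ_self, if_true]
        norm_num
        omega
    · have := hf 1 le_rfl (by omega)
      simp only [Umap, Function.comp_apply, lt_irrefl, if_false, show 1 < m by omega, if_true]
      norm_num at this ⊢
      omega
  | genH =>
    intro x S h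
    rw [isC4FaceMagic_four_iff] at h ⊢
    obtain ⟨hb, hf, s⟩ := h
    refine ⟨hb.comp (MemKBLS.genH.bijOn (by omega)), ?_, ?_⟩
    · intro i h1 h2
      have := hf i h1 h2
      norm_num [Hmap, wrap_four]
      omega
    · norm_num [Hmap, wrap_four]
      omega
  | genF =>
    intro x S h
    rw [isC4FaceMagic_four_iff] at h ⊢
    obtain ⟨hb, hf, s⟩ := h
    refine ⟨hb.comp (MemKBLS.genF.bijOn (by omega)), ?_, ?_⟩
    · intro i h1 h2
      have := hf i h1 h2
      norm_num [Fmap]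
      omega
    · norm_num [Fmap]
      omega

/-- Column reflection in the even-numbered rows. -/
def twist (p : ℕ × ℕ) : ℕ × ℕ := (p.1, if p.1 % 2 = 1 then p.2 else 5 - p.2)

theorem twist_mem_grid {m : ℕ} {p : ℕ × ℕ} (hp : p ∈ grid m) : twist p ∈ grid m := by
  rw [mem_grid] at hp ⊢
  simp only [twist]
  split_ifs <;> omega

theorem twist_twist {m : ℕ} {p : ℕ × ℕ} (hp : p ∈ grid m) : twist (twist p) = p := by
  rw [mem_grid] at hp
  simp only [twist]
  ext <;> simp only
  split_ifs <;> omega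

theorem twist_bijOn (m : ℕ) : Set.BijOn twist (grid m) (grid m) :=
  Set.InvOn.bijOn ⟨fun _ h => twist_twist h, fun _ h => twist_twist h⟩
    (fun _ h => twist_mem_grid h) (fun _ h => twist_mem_grid h)

/-- A bijective labeling all of whose twisted rows have the form `(u, a - u, N - (a - u), N - u)`
with `N = 4 * m + 1` is face-magic. -/
theorem isC4FaceMagic_of_twist {m a : ℕ} (hmo : Odd m) {x : ℕ × ℕ → ℕ}
    (hb : Set.BijOn x (grid m) (Set.Icc 1 (m * 4)))
    (h : ∀ i, 1 ≤ i → i ≤ m → x (twist (i, 1)) + x (twist (i, 4)) = 4 * m + 1 ∧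
      x (twist (i, 2)) + x (twist (i, 3)) = 4 * m + 1 ∧
      x (twist (i, 1)) + x (twist (i, 2)) = a) :
    IsC4FaceMagic m 4 x (2 * (4 * m + 1)) := by
  rw [isC4FaceMagic_four_iff]
  refine ⟨hb, ?_, ?_⟩
  · intro i h1 h2
    have e1 := h i h1 (by omega)
    have e2 := h (i + 1) (by omega) h2
    rcases Nat.mod_two_eq_zero_or_one i with hi | hi
    · have hi' : (i + 1) % 2 = 1 := by omega
      norm_num [twist, hi, hi'] at e1 e2
      omega
    · have hi' : (i + 1) % 2 = 0 := by omega
      norm_num [twist, hi, hi'] at e1 e2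
      omega
  · have hm : m % 2 = 1 := Nat.odd_iff.1 hmo
    have e1 := h 1 le_rfl (by omega)
    have e2 := h m (by omega) le_rfl
    norm_num [twist, hm] at e1 e2
    omega

theorem IsC4FaceMagic.sum_eq {m S : ℕ} {x : ℕ × ℕ → ℕ} (h : IsC4FaceMagic m 4 x S) :
    ∑ i ∈ Finset.Icc 1 m, (x (i, 1) + x (i, 2) + x (i, 3) + x (i, 4)) = m * (2 * (4 * m + 1)) := by
  have h1 : ∑ p ∈ Finset.Icc 1 m ×ˢ Finset.Icc 1 4, x p = ∑ v ∈ Finset.Icc 1 (m * 4), v := by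
    apply Finset.sum_nbij x
    · intro p hp
      rw [Finset.mem_product, Finset.mem_Icc, Finset.mem_Icc] at hp
      have := h.1.mapsTo (mem_grid.2 hp)
      simpa using this
    · simpa using h.1.injOn
    · simpa using h.1.surjOn
    · exact fun _ _ => rfl
  rw [Finset.sum_product] at h1
  have h2 : ∀ i, ∑ j ∈ Finset.Icc 1 4, x (i, j) = x (i, 1) + x (i, 2) + x (i, 3) + x (i, 4) := by
    intro i
    simp [Finset.sum_Icc_succ_top]
  simp only [h2] at h1
  rw [h1]
  have h3 : ∀ n : ℕ, 2 * ∑ v ∈ Finset.Icc 1 n, v = n * (n + 1) := by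
    intro n
    induction n with
    | zero => simp
    | succ n ih => rw [Finset.sum_Icc_succ_top (by omega), mul_add, ih]; ring
  have := h3 (m * 4)
  linarith

theorem IsC4FaceMagic.twist_rows {m S : ℕ} (hmo : Odd m) {x : ℕ × ℕ → ℕ}
    (h : IsC4FaceMagic m 4 x S) :
    ∀ i, 1 ≤ i → i ≤ m → x (twist (i, 1)) + x (twist (i, 4)) = 4 * m + 1 ∧
      x (twist (i, 2)) + x (twist (i, 3)) = 4 * m + 1 ∧
      x (twist (i, 1)) + x (twist (i, 2)) = x (1, 1) + x (1, 2) := by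
  have hsum := h.sum_eq
  rw [isC4FaceMagic_four_iff] at h
  obtain ⟨-, hf, s1, s2, s3, s4⟩ := h
  have hm2 : m % 2 = 1 := Nat.odd_iff.1 hmo
  have rows : ∀ i, 1 ≤ i → i ≤ m →
      (i % 2 = 1 → x (i, 1) + x (i, 2) = x (1, 1) + x (1, 2) ∧
        x (i, 2) + x (i, 3) = x (1, 2) + x (1, 3) ∧
        x (i, 3) + x (i, 4) = x (1, 3) + x (1, 4) ∧
        x (i, 4) + x (i, 1) = x (1, 4) + x (1, 1)) ∧
      (i % 2 = 0 → x (i, 1) + x (i, 2) + (x (1, 1) + x (1, 2)) = S ∧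
        x (i, 2) + x (i, 3) + (x (1, 2) + x (1, 3)) = S ∧
        x (i, 3) + x (i, 4) + (x (1, 3) + x (1, 4)) = S ∧
        x (i, 4) + x (i, 1) + (x (1, 4) + x (1, 1)) = S) := by
    intro i h1
    induction i, h1 using Nat.le_induction with
    | base => intro _; simp
    | succ i h1 ih =>
      intro h2
      have e := ih (by omega)
      have e' := hf i h1 h2
      rcases Nat.mod_two_eq_zero_or_one i with hi | hi
      · have := e.2 hi
        exact ⟨fun _ => by omega, fun _ => by omega⟩
      · have := e.1 hi
        exact ⟨fun _ => by omega, fun _ => by omega⟩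
  have em := (rows m (by omega) le_rfl).1 hm2
  have hrow : ∀ i ∈ Finset.Icc 1 m, x (i, 1) + x (i, 2) + x (i, 3) + x (i, 4) = S := by
    intro i hi
    rw [Finset.mem_Icc] at hi
    have e := rows i hi.1 hi.2
    rcases Nat.mod_two_eq_zero_or_one i with hi | hi
    · have := e.2 hi
      omega
    · have := e.1 hi
      omega
  rw [Finset.sum_congr rfl hrow, Finset.sum_const, Nat.card_Icc, smul_eq_mul,
    Nat.add_sub_cancel] at hsum
  have hS : S = 2 * (4 * m + 1) := Nat.eq_of_mul_eq_mul_left (by omega) hsum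
  intro i h1 h2
  have e := rows i h1 h2
  rcases Nat.mod_two_eq_zero_or_one i with hi | hi
  · have := e.2 hi
    norm_num [twist, hi]
    omega
  · have := e.1 hi
    norm_num [twist, hi]
    omega

/-- The twisted row `(u, N - d - u, d + u, N - u)` with `N = 4 * m + 1`. -/
def rowLabel (m d u j : ℕ) : ℕ :=
  if j = 1 then u else if j = 2 then 4 * m + 1 - d - u else if j = 3 then d + u
  else 4 * m + 1 - u

/-- The labeling, zero outside the grid, whose `i`-th twisted row is determined by the `i`-th
entry of `L`. -/
def labelingOfList (m d : ℕ) (L : List ℕ) (p : ℕ × ℕ) : ℕ :=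
  if (1 ≤ p.1 ∧ p.1 ≤ m) ∧ 1 ≤ p.2 ∧ p.2 ≤ 4 then
    rowLabel m d (L.getD (p.1 - 1) 0) (twist p).2
  else 0

theorem labelingOfList_apply {m d : ℕ} {L : List ℕ} {p : ℕ × ℕ} (hp : p ∈ grid m) :
    labelingOfList m d L p = rowLabel m d (L.getD (p.1 - 1) 0) (twist p).2 :=
  if_pos (mem_grid.1 hp)

theorem labelingOfList_twist {m d : ℕ} {L : List ℕ} {p : ℕ × ℕ} (hp : p ∈ grid m) :
    labelingOfList m d L (twist p) = rowLabel m d (L.getD (p.1 - 1) 0) p.2 := by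
  rw [labelingOfList_apply (twist_mem_grid hp), twist_twist hp]
  rfl

theorem labelingOfList_of_not_mem {m d : ℕ} {L : List ℕ} {p : ℕ × ℕ} (hp : p ∉ grid m) :
    labelingOfList m d L p = 0 :=
  if_neg (fun h => hp (mem_grid.2 h))

theorem labelingOfList_bijOn {m d : ℕ} (hd : 0 < d) (hdm : d ∣ 2 * m) {L : List ℕ}
    (hL : L ∈ transversals (fun y => 4 * m + 1 - d - y) m (evenBlocks m d)) :
    Set.BijOn (labelingOfList m d L) (grid m) (Set.Icc 1 (m * 4)) := by
  obtain ⟨hlen, hmem, hpw⟩ := mem_transversals.1 hL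
  rw [List.pairwise_iff_getElem] at hpw
  have hu : ∀ i, 1 ≤ i → i ≤ m → L.getD (i - 1) 0 ∈ evenBlocks m d := by
    intro i h1 h2
    rw [List.getD_eq_getElem _ _ (by omega)]
    exact hmem _ (List.getElem_mem _)
  have hne : ∀ i i', 1 ≤ i → i < i' → i' ≤ m →
      L.getD (i' - 1) 0 ≠ L.getD (i - 1) 0 ∧
        L.getD (i' - 1) 0 ≠ 4 * m + 1 - d - L.getD (i - 1) 0 := by
    intro i i' h1 h2 h3
    rw [List.getD_eq_getElem _ _ (by omega), List.getD_eq_getElem _ _ (by omega)]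
    exact hpw (i - 1) (i' - 1) (by omega) (by omega) (by omega)
  have hbound : ∀ u ∈ evenBlocks m d, 1 ≤ u ∧ u + d ≤ 4 * m := fun u h =>
    ⟨(mem_evenBlocks.1 h).1.1, (shift_not_mem_evenBlocks hd hdm h).1⟩
  have hrefl : ∀ u ∈ evenBlocks m d, 4 * m + 1 - u ∉ evenBlocks m d := fun u h h' => by
    have := hbound u h
    exact (reflect_mem_evenBlocks hd hdm this.1 (by omega)).1 h' h
  have hrow : ∀ u ∈ evenBlocks m d, ∀ u' ∈ evenBlocks m d, ∀ j j', 1 ≤ j → j ≤ 4 → 1 ≤ j' →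
      j' ≤ 4 → rowLabel m d u j = rowLabel m d u' j' →
      (u = u' ∧ j = j') ∨ u = 4 * m + 1 - d - u' := by
    intro u hu u' hu' j j' h1 h2 h3 h4 h
    have b := hbound u hu
    have b' := hbound u' hu'
    have c : u + d ≠ u' := fun e => (shift_not_mem_evenBlocks hd hdm hu).2 (e ▸ hu')
    have c' : u' + d ≠ u := fun e => (shift_not_mem_evenBlocks hd hdm hu').2 (e ▸ hu)
    have r : 4 * m + 1 - u ≠ u' := fun e => hrefl u hu (e ▸ hu')
    have r' : 4 * m + 1 - (4 * m + 1 - d - u) ≠ 4 * m + 1 - d - u' := fun e =>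
      hrefl _ (partner_mem_evenBlocks hd hdm hu) (e ▸ partner_mem_evenBlocks hd hdm hu')
    interval_cases j <;> interval_cases j' <;> norm_num [rowLabel] at h ⊢ <;> omega
  have hmaps : Set.MapsTo (labelingOfList m d L) (grid m) (Set.Icc 1 (m * 4)) := by
    intro p hp
    rw [labelingOfList_apply hp]
    have hb := hbound _ (hu p.1 (mem_grid.1 hp).1.1 (mem_grid.1 hp).1.2)
    rw [Set.mem_Icc, rowLabel]
    split_ifs <;> omega
  have hinj : Set.InjOn (labelingOfList m d L ∘ twist) (grid m) := by
    intro p hp q hq h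
    simp only [Function.comp_apply] at h
    rw [labelingOfList_twist hp, labelingOfList_twist hq] at h
    rw [mem_grid] at hp hq
    have hup := hu p.1 hp.1.1 hp.1.2
    have huq := hu q.1 hq.1.1 hq.1.2
    have hr := hrow _ hup _ huq _ _ hp.2.1 hp.2.2 hq.2.1 hq.2.2 h
    rcases lt_trichotomy p.1 q.1 with hlt | heq | hlt
    · have := hne _ _ hp.1.1 hlt hq.1.2
      have := hbound _ hup
      have := hbound _ huq
      omega
    · refine Prod.ext heq ?_
      rw [heq] at hr
      have := partner_ne hd hdm huq
      omega
    · have := hne _ _ hq.1.1 hlt hp.1.2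
      omega
  have hinj' : Set.InjOn (labelingOfList m d L) (grid m) := by
    intro p hp q hq h
    rw [← twist_twist hp, ← twist_twist hq] at h
    have := hinj (twist_mem_grid hp) (twist_mem_grid hq) h
    rw [← twist_twist hp, ← twist_twist hq, this]
  refine ⟨hmaps, hinj', ?_⟩
  have hgrid : grid m = ↑(Finset.Icc 1 m ×ˢ Finset.Icc 1 4) := by
    simp [grid]
  have himg : Set.Icc 1 (m * 4) = ↑(Finset.Icc 1 (m * 4)) := by simp
  rw [hgrid] at hmaps hinj' ⊢
  rw [himg] at hmaps ⊢
  exact Finset.surjOn_of_injOn_of_card_le _ hmaps hinj' (by simp)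

theorem labelingOfList_isC4FaceMagic {m d : ℕ} (hmo : Odd m) (hd : 0 < d) (hdm : d ∣ 2 * m)
    {L : List ℕ} (hL : L ∈ transversals (fun y => 4 * m + 1 - d - y) m (evenBlocks m d)) :
    IsC4FaceMagic m 4 (labelingOfList m d L) (2 * (4 * m + 1)) := by
  refine isC4FaceMagic_of_twist (a := 4 * m + 1 - d) hmo (labelingOfList_bijOn hd hdm hL) ?_
  intro i h1 h2
  obtain ⟨hlen, hmem, -⟩ := mem_transversals.1 hL
  have hu : L.getD (i - 1) 0 ∈ evenBlocks m d := by
    rw [List.getD_eq_getElem _ _ (by omega)]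
    exact hmem _ (List.getElem_mem _)
  have hb := (shift_not_mem_evenBlocks hd hdm hu).1
  generalize hLi : L.getD (i - 1) 0 = u at hb
  have hg : ∀ j, 1 ≤ j → j ≤ 4 → (i, j) ∈ grid m := fun j h h' => mem_grid.2 ⟨⟨h1, h2⟩, h, h'⟩
  rw [labelingOfList_twist (hg 1 (by norm_num) (by norm_num)),
    labelingOfList_twist (hg 2 (by norm_num) (by norm_num)),
    labelingOfList_twist (hg 3 (by norm_num) (by norm_num)),
    labelingOfList_twist (hg 4 (by norm_num) (by norm_num)), hLi]
  norm_num [rowLabel]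
  omega

/-- Every face-magic labeling with label `1` at `(1, 1)` comes from a list. -/
theorem IsC4FaceMagic.exists_list {m S : ℕ} (hmo : Odd m) {x : ℕ × ℕ → ℕ}
    (h : IsC4FaceMagic m 4 x S) (hx : x (1, 1) = 1) :
    ∃ d, 0 < d ∧ d ∣ 2 * m ∧ ∃ l,
      1 :: l ∈ transversals (fun y => 4 * m + 1 - d - y) m (evenBlocks m d) ∧
      ∀ p ∈ grid m, x p = labelingOfList m d (1 :: l) p := by
  have hm1 : 1 ≤ m := hmo.pos
  have hrows := h.twist_rows hmo
  have hb : Set.BijOn x (grid m) (Set.Icc 1 (m * 4)) := h.1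
  have hbt := hb.comp (twist_bijOn m)
  have hg : ∀ i j, 1 ≤ i → i ≤ m → 1 ≤ j → j ≤ 4 → (i, j) ∈ grid m :=
    fun i j a b c e => mem_grid.2 ⟨⟨a, b⟩, c, e⟩
  obtain ⟨z, hz⟩ : ∃ z : ℕ → ℕ → ℕ, ∀ i j, z i j = x (twist (i, j)) := ⟨_, fun _ _ => rfl⟩
  simp only [← hz] at hrows
  have hrange : ∀ i j, 1 ≤ i → i ≤ m → 1 ≤ j → j ≤ 4 → 1 ≤ z i j ∧ z i j ≤ 4 * m := by
    intro i j a b c e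
    have := hbt.mapsTo (hg i j a b c e)
    rw [Set.mem_Icc, Function.comp_apply, ← hz] at this
    omega
  have hzinj : ∀ i j i' j', 1 ≤ i → i ≤ m → 1 ≤ j → j ≤ 4 → 1 ≤ i' → i' ≤ m → 1 ≤ j' → j' ≤ 4 →
      z i j = z i' j' → i = i' ∧ j = j' := by
    intro i j i' j' a b c e a' b' c' e' heq
    rw [hz, hz] at heq
    simpa using hbt.injOn (hg i j a b c e) (hg i' j' a' b' c' e') heq
  have hzsurj : ∀ y, 1 ≤ y → y ≤ 4 * m → ∃ i j, (1 ≤ i ∧ i ≤ m) ∧ (1 ≤ j ∧ j ≤ 4) ∧ z i j = y := by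
    intro y h1 h2
    obtain ⟨p, hp, hpy⟩ := hbt.surjOn (show y ∈ Set.Icc 1 (m * 4) by rw [Set.mem_Icc]; omega)
    rw [mem_grid] at hp
    exact ⟨p.1, p.2, hp.1, hp.2, (hz _ _).trans hpy⟩
  have hz11 : z 1 1 = 1 := by rw [hz]; exact hx
  have hz12 : z 1 2 = x (1, 2) := by rw [hz]; rfl
  rw [hx, ← hz12] at hrows
  have hfirst := hrows 1 le_rfl hm1
  have hr12 := hrange 1 2 le_rfl hm1 (by norm_num) (by norm_num)
  have hne : z 1 2 ≠ z 1 4 := fun e => by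
    have := hzinj 1 2 1 4 le_rfl hm1 (by norm_num) (by norm_num) le_rfl hm1 (by norm_num)
      (by norm_num) e
    omega
  obtain ⟨d, hd⟩ : ∃ d, d = 4 * m - z 1 2 := ⟨_, rfl⟩
  have hdpos : 0 < d := by omega
  have hzd : ∀ i, 1 ≤ i → i ≤ m → z i 3 = z i 1 + d ∧ z i 4 = z i 2 + d := by
    intro i a b
    have := hrows i a b
    omega
  obtain ⟨hdvd, hW⟩ := eq_evenBlocks_of_shift (m := m) (d := d)
    (W := fun y => ∃ i, (1 ≤ i ∧ i ≤ m) ∧ (y = z i 1 ∨ y = z i 2)) hdpos (by omega)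
    (by
      rintro y ⟨i, ⟨a, b⟩, hy⟩
      have e := hzd i a b
      obtain ⟨j, hj, hj', hj3, hy'⟩ : ∃ j, 1 ≤ j ∧ j ≤ 4 ∧ 3 ≤ j ∧ y + d = z i j := by
        rcases hy with hy | hy
        · exact ⟨3, by omega, by omega, by omega, by omega⟩
        · exact ⟨4, by omega, by omega, by omega, by omega⟩
      have r1 := hrange i 1 a b (by norm_num) (by norm_num)
      have r2 := hrange i 2 a b (by norm_num) (by norm_num)
      have r3 := hrange i j a b hj hj'
      refine ⟨by omega, by omega, ?_⟩
      rintro ⟨i', ⟨a', b'⟩, hi' | hi'⟩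
      · have := hzinj i j i' 1 a b hj hj' a' b' (by norm_num) (by norm_num) (by omega)
        omega
      · have := hzinj i j i' 2 a b hj hj' a' b' (by norm_num) (by norm_num) (by omega)
        omega)
    (by
      intro y h1 h2 hn
      obtain ⟨i, j, ⟨a, b⟩, ⟨c, e⟩, rfl⟩ := hzsurj y h1 h2
      have e' := hzd i a b
      have r1 := hrange i 1 a b (by norm_num) (by norm_num)
      have r2 := hrange i 2 a b (by norm_num) (by norm_num)
      interval_cases j
      · exact absurd ⟨i, ⟨a, b⟩, Or.inl rfl⟩ hn
      · exact absurd ⟨i, ⟨a, b⟩, Or.inr rfl⟩ hn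
      · exact ⟨by omega, i, ⟨a, b⟩, Or.inl (by omega)⟩
      · exact ⟨by omega, i, ⟨a, b⟩, Or.inr (by omega)⟩)
  have hcons : 1 :: (List.range (m - 1)).map (fun k => z (k + 2) 1)
      = (List.range m).map (fun k => z (k + 1) 1) := by
    obtain ⟨k, rfl⟩ : ∃ k, m = k + 1 := ⟨m - 1, by omega⟩
    rw [List.range_succ_eq_map]
    simp [hz11]
  refine ⟨d, hdpos, hdvd, (List.range (m - 1)).map (fun k => z (k + 2) 1), ?_, ?_⟩
  · rw [hcons, mem_transversals]
    refine ⟨by simp, ?_, ?_⟩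
    · intro y hy
      simp only [List.mem_map, List.mem_range] at hy
      obtain ⟨k, hk, rfl⟩ := hy
      exact (hW _).1 ⟨k + 1, by omega, Or.inl rfl⟩
    · rw [List.pairwise_iff_getElem]
      intro i j hi hj hij
      simp only [List.length_map, List.length_range] at hi hj
      simp only [List.getElem_map, List.getElem_range]
      have e := hrows (i + 1) (by omega) (by omega)
      constructor
      · intro heq
        have := hzinj (j + 1) 1 (i + 1) 1 (by omega) (by omega) (by norm_num) (by norm_num)
          (by omega) (by omega) (by norm_num) (by norm_num) heq
        omega
      · intro heq
        have := hzinj (j + 1) 1 (i + 1) 2 (by omega) (by omega) (by norm_num) (by norm_num)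
          (by omega) (by omega) (by norm_num) (by norm_num) (by omega)
        omega
  · intro p hp
    rw [hcons, labelingOfList_apply hp]
    have hxp : x p = z p.1 (twist p).2 := by
      rw [hz]
      exact congrArg x (twist_twist hp).symm
    have htp := mem_grid.1 (twist_mem_grid hp)
    rw [mem_grid] at hp
    obtain ⟨⟨a, b⟩, -⟩ := hp
    have hget : ((List.range m).map (fun k => z (k + 1) 1)).getD (p.1 - 1) 0 = z p.1 1 := by
      rw [List.getD_eq_getElem _ _ (by simp; omega)]
      simp [Nat.sub_add_cancel a]
    rw [hxp, hget]
    have e := hrows p.1 a b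
    have e' := hzd p.1 a b
    obtain ⟨c, f⟩ := htp.2
    generalize (twist p).2 = j at c f ⊢
    interval_cases j <;> norm_num [rowLabel] <;> omega

theorem labelingOfList_injective {m d d' : ℕ} (hdm : d ∣ 2 * m) (hdm' : d' ∣ 2 * m)
    (hm : 1 ≤ m) {l l' : List ℕ}
    (hl : 1 :: l ∈ transversals (fun y => 4 * m + 1 - d - y) m (evenBlocks m d))
    (hl' : 1 :: l' ∈ transversals (fun y => 4 * m + 1 - d' - y) m (evenBlocks m d'))
    (h : labelingOfList m d (1 :: l) = labelingOfList m d' (1 :: l')) : d = d' ∧ l = l' := by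
  have hd := Nat.le_of_dvd (by omega) hdm
  have hd' := Nat.le_of_dvd (by omega) hdm'
  constructor
  · have hg : (1, 2) ∈ grid m := mem_grid.2 (by simp only; omega)
    have := congrFun h (1, 2)
    rw [labelingOfList_apply hg, labelingOfList_apply hg] at this
    norm_num [rowLabel, twist] at this
    omega
  · have hlen := (mem_transversals.1 hl).1
    have hlen' := (mem_transversals.1 hl').1
    suffices 1 :: l = 1 :: l' from (List.cons.inj this).2
    apply List.ext_getElem (by omega)
    intro i hi hi'
    have hg : (i + 1, 1) ∈ grid m := mem_grid.2 (by simp only; omega)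
    have := congrFun h (twist (i + 1, 1))
    rw [labelingOfList_twist hg, labelingOfList_twist hg] at this
    simpa [rowLabel, List.getElem?_eq_getElem hi, List.getElem?_eq_getElem hi'] using this

theorem card_divisors_two_mul {m : ℕ} (hmo : Odd m) :
    (Nat.divisors (2 * m)).card = 2 * (Nat.divisors m).card := by
  rw [Nat.Coprime.card_divisors_mul (Nat.coprime_two_left.2 hmo),
    Nat.Prime.divisors Nat.prime_two]
  rfl

/-- For `m ≥ 3` odd, the number of Klein bottle equivalence classes of
C₄-face-magic Klein bottle labelings on `𝒦_{m,4}` equals `2^m * (m-1)! * τ(m)`, where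
`τ(m)` is the number of positive divisors of `m`. -/
theorem kleinBottle_count_classes_m4 (m : ℕ) (hm : 3 ≤ m) (hmo : Odd m) :
    ∃ T : Finset (ℕ × ℕ → ℕ),
      T.card = 2 ^ m * Nat.factorial (m - 1) * (Nat.divisors m).card ∧
      (∀ x ∈ T, ∃ S, IsC4FaceMagic m 4 x S) ∧
      (∀ x ∈ T, ∀ y ∈ T, x ≠ y → ¬ KBEquiv m 4 x y) ∧
      (∀ y, (∃ S, IsC4FaceMagic m 4 y S) → ∃ x ∈ T, KBEquiv m 4 x y) := by
  have hm1 : 1 ≤ m := by omega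
  obtain ⟨k, rfl⟩ : ∃ k, m = k + 1 := ⟨m - 1, by omega⟩
  let σ : ℕ → ℕ → ℕ := fun d y => 4 * (k + 1) + 1 - d - y
  let C : ℕ → Finset (List ℕ) := fun d =>
    transversals (σ d) k (evenBlocks (k + 1) d \ {1, σ d 1})
  have one_mem : ∀ d, 1 ∈ evenBlocks (k + 1) d := fun d => by
    rw [mem_evenBlocks]
    exact ⟨by omega, by simp⟩
  have hC : ∀ d l, l ∈ C d ↔ 1 :: l ∈ transversals (σ d) (k + 1) (evenBlocks (k + 1) d) :=
    fun d l => by simp only [C, cons_mem_transversals, one_mem, true_and]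
  have hcard : ∀ d ∈ Nat.divisors (2 * (k + 1)), (C d).card = 2 ^ k * k.factorial := by
    intro d hd
    have hdm := Nat.dvd_of_mem_divisors hd
    have hdp := Nat.pos_of_mem_divisors hd
    have hbd : ∀ y ∈ evenBlocks (k + 1) d, σ d (σ d y) = y := fun y hy => by
      have := (shift_not_mem_evenBlocks hdp hdm hy).1
      simp only [σ]
      omega
    have hmaps : ∀ y ∈ evenBlocks (k + 1) d, σ d y ∈ evenBlocks (k + 1) d :=
      fun y hy => partner_mem_evenBlocks hdp hdm hy
    have hfix : ∀ y ∈ evenBlocks (k + 1) d, σ d y ≠ y := fun y hy => partner_ne hdp hdm hy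
    apply card_transversals
    · rw [Finset.card_sdiff_of_subset, Finset.card_pair (hfix 1 (one_mem d)).symm,
        card_evenBlocks hdp hdm]
      · omega
      · intro y hy
        simp only [Finset.mem_insert, Finset.mem_singleton] at hy
        rcases hy with rfl | rfl
        · exact one_mem d
        · exact hmaps _ (one_mem d)
    · intro y hy
      simp only [Finset.mem_sdiff, Finset.mem_insert, Finset.mem_singleton, not_or] at hy ⊢
      refine ⟨hmaps y hy.1, fun h => hy.2.2 ?_, fun h => hy.2.1 ?_⟩
      · rw [← h, hbd y hy.1]
      · rw [← hbd y hy.1, h, hbd 1 (one_mem d)]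
    · exact fun y hy => hbd y (Finset.mem_sdiff.1 hy).1
    · exact fun y hy => hfix y (Finset.mem_sdiff.1 hy).1
  classical
  refine ⟨((Nat.divisors (2 * (k + 1))).sigma C).image
    (fun q => labelingOfList (k + 1) q.1 (1 :: q.2)), ?_, ?_, ?_, ?_⟩
  · rw [Finset.card_image_of_injOn, Finset.card_sigma, Finset.sum_congr rfl hcard,
      Finset.sum_const, card_divisors_two_mul hmo, smul_eq_mul, Nat.add_sub_cancel]
    · ring
    · rintro ⟨d, l⟩ hq ⟨d', l'⟩ hq' h
      simp only [Finset.coe_sigma, Set.mem_sigma_iff, Finset.mem_coe] at hq hq'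
      obtain ⟨rfl, rfl⟩ := labelingOfList_injective (Nat.dvd_of_mem_divisors hq.1)
        (Nat.dvd_of_mem_divisors hq'.1) hm1 ((hC _ _).1 hq.2) ((hC _ _).1 hq'.2) h
      rfl
  · intro x hx
    simp only [Finset.mem_image, Finset.mem_sigma] at hx
    obtain ⟨⟨d, l⟩, ⟨hd, hl⟩, rfl⟩ := hx
    exact ⟨_, labelingOfList_isC4FaceMagic hmo (Nat.pos_of_mem_divisors hd)
      (Nat.dvd_of_mem_divisors hd) ((hC _ _).1 hl)⟩
  · intro x hx y hy hne ⟨A, hA, hAxy⟩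
    simp only [Finset.mem_image, Finset.mem_sigma] at hx hy
    obtain ⟨⟨d, l⟩, ⟨hd, hl⟩, rfl⟩ := hx
    obtain ⟨⟨d', l'⟩, -, rfl⟩ := hy
    have h11 : ((1 : ℕ), (1 : ℕ)) ∈ grid (k + 1) := mem_grid.2 (by simp only; omega)
    have hone : ∀ d l, labelingOfList (k + 1) d (1 :: l) (1, 1) = 1 := fun d l => by
      rw [labelingOfList_apply h11]
      simp [twist, rowLabel]
    have hfix : A (1, 1) = (1, 1) := by
      refine (labelingOfList_bijOn (Nat.pos_of_mem_divisors hd) (Nat.dvd_of_mem_divisors hd)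
        ((hC _ _).1 hl)).injOn (hA.mapsTo h11) h11 ?_
      dsimp only
      rw [hone, ← hone d' l']
      exact (hAxy _ h11).symm
    apply hne
    funext p
    by_cases hp : p ∈ grid (k + 1)
    · have := hAxy p hp
      rw [hA.eq_of_fixes hm1 hfix p hp] at this
      exact this.symm
    · dsimp only
      rw [labelingOfList_of_not_mem hp, labelingOfList_of_not_mem hp]
  · rintro y ⟨S, hy⟩
    obtain ⟨p, hp, hp1⟩ := hy.1.surjOn (show 1 ∈ Set.Icc 1 ((k + 1) * 4) by
      rw [Set.mem_Icc]; omega)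
    obtain ⟨A, hA, hAp⟩ := exists_memKBLS_apply_eq hp
    obtain ⟨B, hB, -, hAB⟩ := hA.exists_inverse hm1
    obtain ⟨d, hd, hdm, l, hl, hx⟩ := (hy.comp_memKBLS (by omega) hA).exists_list hmo
      (by rw [Function.comp_apply, hAp, hp1])
    refine ⟨labelingOfList (k + 1) d (1 :: l), ?_, B, hB, ?_⟩
    · rw [Finset.mem_image]
      exact ⟨⟨d, l⟩, Finset.mem_sigma.2 ⟨Nat.mem_divisors.2 ⟨hdm, by omega⟩, (hC _ _).2 hl⟩, rfl⟩
    · intro q hq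
      rw [← hx _ (hB.mapsTo hq), Function.comp_apply, hAB q hq]
end

section
/- Let m ≥ 3 be an odd integer and b an integer with either 3m+1 ≤ b ≤ 4m+1 or 8m ≤ b ≤ 9m+1. Then there exist at least (m−1)! pairwise Klein bottle nonequivalent C₄-face-magic Klein bottle labelings x on 𝒦_{m,6} satisfying x_{1,1} + x_{1,2} = 6m and x_{1,2} + x_{1,3} = b. -/
/-- The label in column `j` of a row `(w, 6m-w, w+b-6m, 12m+1-b-w, w+1, 6m+1-w)`. -/
def rowEntry (m b w j : ℕ) : ℕ :=
  if j = 1 then w else if j = 2 then 6 * m - w else if j = 3 then b + w - 6 * m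
  else if j = 4 then 12 * m + 1 - b - w else if j = 5 then w + 1 else 6 * m + 1 - w

/-- The first entries `X 1, …, X m` generate rows partitioning `{1, …, 6m}`. -/
def RowsPartition (m b : ℕ) (X : ℕ → ℕ) : Prop :=
  (∀ r j, 1 ≤ r → r ≤ m → 1 ≤ j → j ≤ 6 →
    1 ≤ rowEntry m b (X r) j ∧ rowEntry m b (X r) j ≤ 6 * m) ∧
  (∀ r j r' j', 1 ≤ r → r ≤ m → 1 ≤ j → j ≤ 6 → 1 ≤ r' → r' ≤ m → 1 ≤ j' → j' ≤ 6 →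
    rowEntry m b (X r) j = rowEntry m b (X r') j' → r = r' ∧ j = j')

theorem rowsPartition_top (m : ℕ) : RowsPartition m (9 * m + 1) fun r => 3 * r - 1 := by
  constructor
  · intro r j h1 h2 h3 h4
    interval_cases j <;> simp [rowEntry] <;> omega
  · intro r j r' j' h1 h2 h3 h4 h5 h6 h7 h8 h
    interval_cases j <;> interval_cases j' <;> simp [rowEntry] at h ⊢ <;> omega

theorem rowsPartition_high {m b : ℕ} (h1 : 8 * m ≤ b) (h2 : b ≤ 9 * m) :
    RowsPartition m b fun r => if r ≤ 9 * m - b then 2 * r - 1 else 3 * r - (9 * m - b) - 2 := by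
  obtain ⟨s, rfl, hs⟩ : ∃ s, b = 9 * m - s ∧ s ≤ m := ⟨9 * m - b, by omega, by omega⟩
  have e : 9 * m - (9 * m - s) = s := by omega
  simp only [e]
  constructor
  · intro r j h1 h2 h3 h4
    interval_cases j <;> simp [rowEntry] <;> split_ifs <;> omega
  · intro r j r' j' h1 h2 h3 h4 h5 h6 h7 h8 h
    interval_cases j <;> interval_cases j' <;> simp [rowEntry] at h ⊢ <;> split_ifs at h <;> omega

theorem rowEntry_reflect {m b w j : ℕ} (hw : w ≤ 6 * m) (hb : b ≤ 12 * m + 1)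
    (h1 : 1 ≤ j) (h6 : j ≤ 6) :
    rowEntry m (12 * m + 1 - b) (6 * m - w) j =
      rowEntry m b w (if j % 2 = 1 then j + 1 else j - 1) := by
  interval_cases j <;> simp [rowEntry] <;> omega

theorem RowsPartition.reflect {m b : ℕ} {X : ℕ → ℕ} (hb : b ≤ 12 * m + 1)
    (hX : RowsPartition m b X) : RowsPartition m (12 * m + 1 - b) fun r => 6 * m - X r := by
  have hw : ∀ r, 1 ≤ r → r ≤ m → X r ≤ 6 * m := fun r h1 h2 =>
    (hX.1 r 1 h1 h2 le_rfl (by norm_num)).2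
  constructor
  · intro r j h1 h2 h3 h4
    rw [rowEntry_reflect (hw r h1 h2) hb h3 h4]
    exact hX.1 _ _ h1 h2 (by split_ifs <;> omega) (by split_ifs <;> omega)
  · intro r j r' j' h1 h2 h3 h4 h5 h6 h7 h8 h
    rw [rowEntry_reflect (hw r h1 h2) hb h3 h4, rowEntry_reflect (hw r' h5 h6) hb h7 h8] at h
    obtain ⟨hr, hj⟩ := hX.2 _ _ _ _ h1 h2 (by split_ifs <;> omega) (by split_ifs <;> omega)
      h5 h6 (by split_ifs <;> omega) (by split_ifs <;> omega) h
    exact ⟨hr, by split_ifs at hj <;> omega⟩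

theorem exists_rowsPartition {m b : ℕ}
    (hb : (3 * m + 1 ≤ b ∧ b ≤ 4 * m + 1) ∨ (8 * m ≤ b ∧ b ≤ 9 * m + 1)) :
    ∃ X, RowsPartition m b X := by
  rcases hb with ⟨h1, h2⟩ | ⟨h1, h2⟩
  · have h := (rowsPartition_high (m := m) (b := 12 * m + 1 - b) (by omega) (by omega)).reflect
      (by omega)
    rw [show 12 * m + 1 - (12 * m + 1 - b) = b by omega] at h
    exact ⟨_, h⟩
  · rcases Nat.lt_or_ge (9 * m) b with h | h
    · obtain rfl : b = 9 * m + 1 := by omega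
      exact ⟨_, rowsPartition_top m⟩
    · exact ⟨_, rowsPartition_high h1 h⟩

/-- Place the row generated by `X (ρ i)` in row `i`, reversed when `i` is even. -/
def rowLabeling (m b : ℕ) (X ρ : ℕ → ℕ) (p : ℕ × ℕ) : ℕ :=
  rowEntry m b (X (ρ p.1)) (if p.1 % 2 = 1 then p.2 else 7 - p.2)

/-- `ρ` permutes `{1, …, m}` (stated as: it is an injective self-map). -/
def PermutesRows (m : ℕ) (ρ : ℕ → ℕ) : Prop :=
  Set.MapsTo ρ (Set.Icc 1 m) (Set.Icc 1 m) ∧ Set.InjOn ρ (Set.Icc 1 m)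

theorem RowsPartition.rowLabeling_row_eq {m b : ℕ} {X ρ ρ' : ℕ → ℕ} (hX : RowsPartition m b X)
    (hρ : PermutesRows m ρ) (hρ' : PermutesRows m ρ') {p q : ℕ × ℕ}
    (hp : p ∈ Set.Icc 1 m ×ˢ Set.Icc 1 6) (hq : q ∈ Set.Icc 1 m ×ˢ Set.Icc 1 6)
    (h : rowLabeling m b X ρ p = rowLabeling m b X ρ' q) :
    ρ p.1 = ρ' q.1 ∧
      (if p.1 % 2 = 1 then p.2 else 7 - p.2) = (if q.1 % 2 = 1 then q.2 else 7 - q.2) := by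
  obtain ⟨i, j⟩ := p
  obtain ⟨i', j'⟩ := q
  obtain ⟨hi, hj⟩ := hp
  obtain ⟨hi', hj'⟩ := hq
  have h1 := hρ.1 hi
  have h2 := hρ'.1 hi'
  simp only [Set.mem_Icc] at hi hj hi' hj' h1 h2
  exact hX.2 _ _ _ _ h1.1 h1.2 (by split_ifs <;> omega) (by split_ifs <;> omega)
    h2.1 h2.2 (by split_ifs <;> omega) (by split_ifs <;> omega) h

theorem RowsPartition.isC4FaceMagic {m b : ℕ} {X ρ : ℕ → ℕ} (hm : 1 ≤ m) (hmo : Odd m)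
    (hX : RowsPartition m b X) (hρ : PermutesRows m ρ) :
    IsC4FaceMagic m 6 (rowLabeling m b X ρ) (12 * m + 2) := by
  have bounds : ∀ i, 1 ≤ i → i ≤ m → ∀ j, 1 ≤ j → j ≤ 6 →
      1 ≤ rowEntry m b (X (ρ i)) j ∧ rowEntry m b (X (ρ i)) j ≤ 6 * m := by
    intro i h1 h2 j h3 h4
    have := hρ.1 (Set.mem_Icc.2 ⟨h1, h2⟩)
    exact hX.1 _ _ this.1 this.2 h3 h4
  have positive : ∀ i, 1 ≤ i → i ≤ m → 1 ≤ 6 * m - X (ρ i) ∧ 1 ≤ b + X (ρ i) - 6 * m ∧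
      1 ≤ 12 * m + 1 - b - X (ρ i) := by
    intro i h1 h2
    exact ⟨by simpa [rowEntry] using (bounds i h1 h2 2 (by norm_num) (by norm_num)).1,
      by simpa [rowEntry] using (bounds i h1 h2 3 (by norm_num) (by norm_num)).1,
      by simpa [rowEntry] using (bounds i h1 h2 4 (by norm_num) (by norm_num)).1⟩
  refine ⟨?_, ?_, ?_⟩
  · have maps : Set.MapsTo (rowLabeling m b X ρ) (Set.Icc 1 m ×ˢ Set.Icc 1 6)
        (Set.Icc 1 (m * 6)) := by
      rintro ⟨i, j⟩ ⟨hi, hj⟩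
      simp only [Set.mem_Icc] at hi hj ⊢
      rw [mul_comm m 6]
      exact bounds i hi.1 hi.2 _ (by split_ifs <;> omega) (by split_ifs <;> omega)
    have inj : Set.InjOn (rowLabeling m b X ρ) (Set.Icc 1 m ×ˢ Set.Icc 1 6) := by
      rintro ⟨i, j⟩ hp ⟨i', j'⟩ hq h
      obtain ⟨h1, h2⟩ := hX.rowLabeling_row_eq hρ hρ hp hq h
      obtain rfl : i = i' := hρ.2 hp.1 hq.1 h1
      have hj := hp.2
      have hj' := hq.2
      simp only [Set.mem_Icc] at h2 hj hj'
      have : j = j' := by split_ifs at h2 <;> omega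
      rw [this]
    have surj := Finset.surjOn_of_injOn_of_card_le (s := Finset.Icc 1 m ×ˢ Finset.Icc 1 6)
      (t := Finset.Icc 1 (m * 6)) (rowLabeling m b X ρ) (by simpa using maps) (by simpa using inj)
      (by simp)
    exact ⟨maps, inj, by simpa using surj⟩
  · intro i j h1 h2 h3 h4
    have hi := positive i h1 (by omega)
    have hi' := positive (i + 1) (by omega) h2
    rcases Nat.mod_two_eq_zero_or_one i with h | h
    · have h' : (i + 1) % 2 = 1 := by omega
      interval_cases j <;> simp [rowLabeling, rowEntry, wrap, h, h'] <;> omega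
    · have h' : (i + 1) % 2 = 0 := by omega
      interval_cases j <;> simp [rowLabeling, rowEntry, wrap, h, h'] <;> omega
  · intro j h3 h4
    have hi := positive 1 le_rfl hm
    have hi' := positive m hm le_rfl
    have h := Nat.odd_iff.1 hmo
    interval_cases j <;> simp [rowLabeling, rowEntry, wrap, h] <;> omega

/-- Members of `KBLS(m, 6)` rotate the rows cyclically. -/
theorem MemKBLS.exists_rotation {m : ℕ} {A : ℕ × ℕ → ℕ × ℕ} (hA : MemKBLS m 6 A) :
    ∃ k, ∀ p ∈ Set.Icc 1 m ×ˢ Set.Icc 1 6,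
      A p ∈ Set.Icc 1 m ×ˢ Set.Icc 1 6 ∧ (A p).1 ≡ p.1 + k [MOD m] := by
  induction hA with
  | one => exact ⟨0, fun p hp => ⟨hp, rfl⟩⟩
  | genU =>
    refine ⟨1, ?_⟩
    rintro ⟨i, j⟩ ⟨hi, hj⟩
    simp only [Set.mem_Icc] at hi hj
    by_cases h : i < m
    · simp only [Umap, h, if_true, Set.mem_prod, Set.mem_Icc]
      exact ⟨by omega, rfl⟩
    · obtain rfl : i = m := by omega
      simp only [Umap, h, if_false, Set.mem_prod, Set.mem_Icc]
      exact ⟨by omega, by simp [Nat.ModEq]⟩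
  | genH =>
    refine ⟨0, ?_⟩
    rintro ⟨i, j⟩ ⟨hi, hj⟩
    refine ⟨⟨hi, ?_⟩, rfl⟩
    simp only [Set.mem_Icc, Hmap, wrap]
    split_ifs <;> omega
  | genF =>
    refine ⟨0, ?_⟩
    rintro ⟨i, j⟩ ⟨hi, hj⟩
    refine ⟨⟨hi, ?_⟩, rfl⟩
    simp only [Set.mem_Icc, Fmap] at hj ⊢
    omega
  | @comp f g _ _ ihf ihg =>
    obtain ⟨k, hk⟩ := ihf
    obtain ⟨l, hl⟩ := ihg
    refine ⟨l + k, fun p hp => ?_⟩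
    obtain ⟨h1, h2⟩ := hl p hp
    obtain ⟨h3, h4⟩ := hk _ h1
    refine ⟨h3, h4.trans ?_⟩
    rw [← add_assoc]
    exact h2.add_right k

theorem eq_of_modEq_of_mem_Icc {m i j : ℕ} (hi : i ∈ Set.Icc 1 m) (hj : j ∈ Set.Icc 1 m)
    (h : i ≡ j [MOD m]) : i = j := by
  obtain ⟨a, rfl⟩ := Nat.exists_eq_add_of_le' hi.1
  obtain ⟨b, rfl⟩ := Nat.exists_eq_add_of_le' hj.1
  simp only [Set.mem_Icc] at hi hj
  have := Nat.ModEq.add_right_cancel' 1 h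
  rw [this.eq_of_lt_of_lt (by omega) (by omega)]

theorem RowsPartition.eqOn_of_kbEquiv {m b : ℕ} {X ρ ρ' : ℕ → ℕ} (hm : 1 ≤ m)
    (hX : RowsPartition m b X) (hρ : PermutesRows m ρ) (hρ' : PermutesRows m ρ')
    (h1 : ρ 1 = 1) (h1' : ρ' 1 = 1)
    (h : KBEquiv m 6 (rowLabeling m b X ρ) (rowLabeling m b X ρ')) :
    Set.EqOn ρ ρ' (Set.Icc 1 m) := by
  obtain ⟨A, hA, hxy⟩ := h
  obtain ⟨k, hk⟩ := hA.exists_rotation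
  have row : ∀ i ∈ Set.Icc 1 m, (i, 1) ∈ Set.Icc 1 m ×ˢ Set.Icc 1 6 ∧
      ρ' i = ρ (A (i, 1)).1 := by
    intro i hi
    have hp : (i, 1) ∈ Set.Icc 1 m ×ˢ Set.Icc 1 6 := ⟨hi, by simp⟩
    exact ⟨hp, (hX.rowLabeling_row_eq hρ' hρ hp (hk _ hp).1 (hxy _ hp)).1⟩
  have one_mem : 1 ∈ Set.Icc 1 m := ⟨le_rfl, hm⟩
  obtain ⟨hp, hrow⟩ := row 1 one_mem
  have hA1 : (A (1, 1)).1 = 1 := hρ.2 (hk _ hp).1.1 one_mem (by rw [← hrow, h1, h1'])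
  have hk0 : k ≡ 0 [MOD m] := by
    have := (hk _ hp).2
    rw [hA1] at this
    exact (Nat.ModEq.add_left_cancel' 1 this).symm
  intro i hi
  obtain ⟨hq, hrow'⟩ := row i hi
  rw [hrow', eq_of_modEq_of_mem_Icc (hk _ hq).1.1 hi ((hk _ hq).2.trans (hk0.add_left i))]

/-- The row permutation fixing row `1` and acting as `σ` on rows `2, …, m`. -/
def extendPerm (m : ℕ) (σ : Equiv.Perm (Fin (m - 1))) (i : ℕ) : ℕ :=
  if h : 2 ≤ i ∧ i ≤ m then (σ ⟨i - 2, by omega⟩ : ℕ) + 2 else i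

theorem extendPerm_one (m : ℕ) (σ : Equiv.Perm (Fin (m - 1))) : extendPerm m σ 1 = 1 := by
  simp [extendPerm]

theorem extendPerm_add_two {m : ℕ} (σ : Equiv.Perm (Fin (m - 1))) (i : Fin (m - 1)) :
    extendPerm m σ (i + 2) = σ i + 2 := by
  have : (i : ℕ) + 2 ≤ m := by omega
  simp [extendPerm, this]

theorem permutesRows_extendPerm (m : ℕ) (σ : Equiv.Perm (Fin (m - 1))) :
    PermutesRows m (extendPerm m σ) := by
  constructor
  · intro i hi
    simp only [Set.mem_Icc] at hi ⊢
    unfold extendPerm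
    split_ifs with h
    · have := (σ ⟨i - 2, by omega⟩).isLt
      omega
    · exact hi
  · intro i hi j hj h
    simp only [Set.mem_Icc] at hi hj
    unfold extendPerm at h
    split_ifs at h with h1 h2 h2
    · have := σ.injective (Fin.ext (Nat.add_right_cancel h))
      simp only [Fin.mk.injEq] at this
      omega
    · omega
    · omega
    · exact h

/-- For `m ≥ 3` odd and `3m+1 ≤ b ≤ 4m+1` or `8m ≤ b ≤ 9m+1`, there are
at least `(m-1)!` pairwise Klein bottle nonequivalent C₄-face-magic Klein bottle labelings
`x` on `𝒦_{m,6}` with `x_{1,1} + x_{1,2} = 6m` and `x_{1,2} + x_{1,3} = b`. -/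
theorem kleinBottle_m6_middle (m b : ℕ) (hm : 3 ≤ m) (hmo : Odd m)
    (hb : (3 * m + 1 ≤ b ∧ b ≤ 4 * m + 1) ∨ (8 * m ≤ b ∧ b ≤ 9 * m + 1)) :
    ∃ T : Finset (ℕ × ℕ → ℕ),
      Nat.factorial (m - 1) ≤ T.card ∧
      (∀ x ∈ T, (∃ S, IsC4FaceMagic m 6 x S) ∧
        x (1, 1) + x (1, 2) = 6 * m ∧ x (1, 2) + x (1, 3) = b) ∧
      (∀ x ∈ T, ∀ y ∈ T, x ≠ y → ¬ KBEquiv m 6 x y) := by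
  classical
  obtain ⟨X, hX⟩ := exists_rowsPartition hb
  have key : ∀ σ τ : Equiv.Perm (Fin (m - 1)), KBEquiv m 6 (rowLabeling m b X (extendPerm m σ))
      (rowLabeling m b X (extendPerm m τ)) → σ = τ := by
    intro σ τ h
    have heq := hX.eqOn_of_kbEquiv (by omega) (permutesRows_extendPerm m σ)
      (permutesRows_extendPerm m τ) (extendPerm_one m σ) (extendPerm_one m τ) h
    ext i
    have := heq (show (i : ℕ) + 2 ∈ Set.Icc 1 m from ⟨by omega, by omega⟩)
    rw [extendPerm_add_two, extendPerm_add_two] at this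
    omega
  refine ⟨Finset.univ.image fun σ => rowLabeling m b X (extendPerm m σ), ?_, ?_, ?_⟩
  · rw [Finset.card_image_of_injective, Finset.card_univ, Fintype.card_perm, Fintype.card_fin]
    intro σ τ h
    exact key σ τ ⟨id, .one, fun p _ => (congrFun h p).symm⟩
  · intro x hx
    obtain ⟨σ, -, rfl⟩ := Finset.mem_image.1 hx
    refine ⟨⟨_, hX.isC4FaceMagic (by omega) hmo (permutesRows_extendPerm m σ)⟩, ?_⟩
    have h2 := (hX.1 1 2 le_rfl (by omega) (by norm_num) (by norm_num)).1
    have h3 := (hX.1 1 3 le_rfl (by omega) (by norm_num) (by norm_num)).1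
    simp [rowEntry] at h2 h3
    simp [rowLabeling, rowEntry, extendPerm_one]
    omega
  · intro x hx y hy hxy h
    obtain ⟨σ, -, rfl⟩ := Finset.mem_image.1 hx
    obtain ⟨τ, -, rfl⟩ := Finset.mem_image.1 hy
    exact hxy (by rw [key σ τ h])
end
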